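/- arXiv:1711.03382 — 3 statements merged into one kernel-verified Lean document; each statement's English description precedes it below -/
import Mathlib

section
/- For integers r ≥ 3 and k ≥ 2r+2, if M is a matching in the complete graph K_k (a set of pairwise disjoint edges), then the graph K_k − M (obtained by deleting the edges of M) has a fractional K_r-decomposition, i.e. there exists a non-negative weighting of the copies of K_r in K_k − M such that for every edge e of K_k − M, the total weight of copies of K_r containing e equals 1. -/
open Finset
open scoped Classical

noncomputable def fracCliqueDecomp {V : Type*} [Fintype V] (G : SimpleGraph V) (r : ℕ) : Prop :=
  ∃ w : Finset V → ℝ, (∀ s, 0 ≤ w s) ∧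
    ∀ u v : V, G.Adj u v →
      ∑ s ∈ univ.filter (fun s : Finset V => G.IsNClique r s ∧ u ∈ s ∧ v ∈ s), w s = 1

/-- `M` is a set of pairwise vertex-disjoint (non-loop) edges. -/
def IsMatchingSet {V : Type*} (M : Set (Sym2 V)) : Prop :=
  (∀ e ∈ M, ¬ e.IsDiag) ∧ ∀ e ∈ M, ∀ f ∈ M, e ≠ f → ∀ v : V, v ∈ e → v ∉ f


lemma ineqF (r k m t : ℤ) (hr : 3 ≤ r) (hk : 2*r+2 ≤ k) (hm : 0 ≤ m) (ht0 : 0 ≤ t) (ht : t + 1 ≤ r) :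
    0 ≤ t*(t+1)*(k*(k-1)-2*m) - 2*t*r*(2*m)*(k-2) + r*(r-1)*(2*m)*(2*m-2) := by
  rcases ht0.eq_or_lt with h0 | h0
  · subst h0
    have : 0 ≤ m*(m-1) := by
      rcases hm.eq_or_lt with h | h
      · subst h; simp
      · exact mul_nonneg hm (by omega)
    have h2 : 0 ≤ r*(r-1) := mul_nonneg (by omega) (by omega)
    nlinarith [mul_nonneg this h2]
  rcases le_or_gt m t with h | h
  · -- F(2r+2) ≥ 0 and increasing
    obtain ⟨x, rfl⟩ : ∃ x, k = 2*r+2+x := ⟨k-(2*r+2), by ring⟩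
    have hx : 0 ≤ x := by omega
    have e : t*(t+1)*((2*r+2+x)*((2*r+2+x)-1)-2*m) - 2*t*r*(2*m)*((2*r+2+x)-2) + r*(r-1)*(2*m)*(2*m-2)
      = 4*r^2*((t-m)*(t+1-m)) + (4*r*(t*(t+1) - m*(m-1)) + 2*(t*(t+1))*(r-m) + 2*(t*(t+1)))
        + x*t*((t+1)*x + 4*r*(t-m) + 4*r + 3*(t+1)) := by ring
    rw [e]
    have h1 : 0 ≤ t*(t+1) - m*(m-1) := by nlinarith
    have h2 : 0 ≤ t - m := by omega
    have h3 : 0 ≤ r - m := by omega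
    have h4 : 0 ≤ t + 1 - m := by omega
    have h5 : 0 ≤ r := by omega
    positivity
  · obtain ⟨d, rfl⟩ : ∃ d, m = t+1+d := ⟨m-(t+1), by ring⟩
    have hd : 0 ≤ d := by omega
    obtain ⟨y, rfl⟩ : ∃ y, r = t+1+y := ⟨r-(t+1), by ring⟩
    have hy : 0 ≤ y := by omega
    have hA : 0 < t*(t+1) := by positivity
    rcases hy.eq_or_lt with h1 | h1
    · subst h1
      have : 0 ≤ (k-2*(t+1+d))*(k-2*(t+1+d)-1) := by
        rcases le_or_gt (k-2*(t+1+d)) 0 with h | h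
        · exact mul_nonneg_of_nonpos_of_nonpos h (by omega)
        · exact mul_nonneg h.le (by omega)
      nlinarith [mul_nonneg hA.le this]
    · obtain ⟨z, rfl⟩ : ∃ z, y = z+1 := ⟨y-1, by ring⟩
      have hz : 0 ≤ z := by omega
      set F := t*(t+1)*(k*(k-1)-2*(t+1+d)) - 2*t*(t+1+(z+1))*(2*(t+1+d))*(k-2) + (t+1+(z+1))*((t+1+(z+1))-1)*(2*(t+1+d))*(2*(t+1+d)-2) with hF
      have key : 0 ≤ 4*(t*(t+1))*F := by
        have e2 : 4*(t*(t+1))*F - (2*(t*(t+1))*k - t*(t+1) - 4*t*(t+1+(z+1))*(t+1+d))^2 =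
          16*t*(t+1+d)*(t+1+(z+1))*(z+1)*d + (t*(t+1))*t*(8*(t+1+d)*(z) +7*(t+1)+8*d) := by
          rw [hF]; ring
        nlinarith [sq_nonneg (2*(t*(t+1))*k - t*(t+1) - 4*t*(t+1+(z+1))*(t+1+d)), show 0 ≤ 16*t*(t+1+d)*(t+1+(z+1))*(z+1)*d + (t*(t+1))*t*(8*(t+1+d)*(z) +7*(t+1)+8*d) by positivity]
      by_contra hc
      push Not at hc
      nlinarith

lemma ineqG (r m u : ℤ) (hm : m + 1 ≤ r) (hu : u + 1 ≤ r) (hk : 2*r+2 ≤ 2*m+u) :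
    0 ≤ -r*(r-1)*(u-1) + (u+r-m-1)*r*((2*m+u)-1) - (r-m)*((2*m+u)*((2*m+u)-1)-2*m) := by
  obtain ⟨d, rfl⟩ : ∃ d, m = r-1-d := ⟨r-1-m, by ring⟩
  obtain ⟨e, rfl⟩ : ∃ e, u = r-1-e := ⟨r-1-u, by ring⟩
  obtain ⟨x, rfl⟩ : ∃ x, r = 2*(d+1)+(e+1)+2+x := ⟨r-(2*(d+1)+(e+1)+2), by ring⟩
  have hd : 0 ≤ d := by omega
  have he : 0 ≤ e := by omega
  have hx : 0 ≤ x := by omega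
  ring_nf
  positivity

lemma moment (r a b : ℕ) (hr : 1 ≤ r) (hab : a ≤ b) (hbr : b ≤ r) (μ s : ℝ) (ha : (a:ℝ) ≤ μ) (hb : μ ≤ b)
    (hup : s ≤ (a+b)*μ - a*b)
    (hlow : ∀ t : ℕ, t + 1 ≤ r → (2*t+1)*μ - t*(t+1) ≤ s) :
    ∃ p : ℕ → ℝ, (∀ j, 0 ≤ p j) ∧ (∀ j, p j ≠ 0 → a ≤ j ∧ j ≤ b) ∧
      ∑ j ∈ range (r+1), p j = 1 ∧ ∑ j ∈ range (r+1), p j * j = μ ∧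
      ∑ j ∈ range (r+1), p j * (j:ℝ)^2 = s := by
  -- predicate
  have two : ∀ x y : ℕ, x ≤ r → y ≤ r → ∀ α β : ℝ, 0 ≤ α → 0 ≤ β → α + β = 1 → α*x+β*y = μ →
      (α ≠ 0 → a ≤ x ∧ x ≤ b) → (β ≠ 0 → a ≤ y ∧ y ≤ b) →
      ∃ p : ℕ → ℝ, (∀ j, 0 ≤ p j) ∧ (∀ j, p j ≠ 0 → a ≤ j ∧ j ≤ b) ∧
      ∑ j ∈ range (r+1), p j = 1 ∧ ∑ j ∈ range (r+1), p j * j = μ ∧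
      ∑ j ∈ range (r+1), p j * (j:ℝ)^2 = α*x^2+β*y^2 := by
    intro x y hx hy α β hα hβ h1 h2 h3 h4
    refine ⟨fun j => (if j = x then α else 0) + (if j = y then β else 0), ?_, ?_, ?_, ?_, ?_⟩
    · intro j; positivity
    · intro j hj
      by_cases hjx : j = x
      · subst hjx
        by_cases hα0 : α = 0
        · by_cases hjy : j = y
          · subst hjy; apply h4; intro h; simp [hα0, h] at hj
          · simp [hjy, hα0] at hj
        · exact h3 hα0
      · by_cases hjy : j = y
        · subst hjy; apply h4; intro h; simp [hjx, h] at hj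
        · simp [hjx, hjy] at hj
    all_goals
      simp only [add_mul, sum_add_distrib, ite_mul, zero_mul, sum_ite_eq', mem_range]
      rw [if_pos (by omega), if_pos (by omega)]
    · exact h1
    · exact h2
  have hμ0 : 0 ≤ μ := le_trans (by positivity) ha
  have hμr : μ ≤ r := hb.trans (by exact_mod_cast hbr)
  obtain ⟨t, htr, ht1, ht2⟩ : ∃ t : ℕ, t + 1 ≤ r ∧ (t:ℝ) ≤ μ ∧ μ ≤ t+1 := by
    by_cases h : ⌊μ⌋₊ + 1 ≤ r
    · exact ⟨⌊μ⌋₊, h, Nat.floor_le hμ0, (Nat.lt_floor_add_one μ).le⟩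
    · have h1 : r ≤ ⌊μ⌋₊ := by omega
      have h2 : (r:ℝ) ≤ μ := (Nat.le_floor_iff hμ0).1 h1
      refine ⟨r-1, by omega, ?_, ?_⟩
      · rw [Nat.cast_sub hr]; push_cast; linarith
      · rw [Nat.cast_sub hr]; push_cast; linarith
  obtain ⟨p, p0, ps, p1, pμ, psq⟩ := two t (t+1) (by omega) htr (t+1-μ) (μ-t) (by linarith) (by linarith) (by ring)
    (by push_cast; ring)
    (by
      intro h
      have h' : μ < t+1 := lt_of_le_of_ne ht2 (fun e => h (by linarith))
      constructor
      · have : (a:ℝ) < t+1 := by linarith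
        have : a < t+1 := by exact_mod_cast this
        omega
      · exact_mod_cast ht1.trans hb)
    (by
      intro h
      have h' : t < μ := lt_of_le_of_ne ht1 (fun e => h (by linarith))
      constructor
      · exact_mod_cast ha.trans ht2
      · have : (t:ℝ) < b := by linarith
        have : t < b := by exact_mod_cast this
        omega)
  obtain ⟨α, β, hα, hβ, hαβ, hm, hs2⟩ : ∃ α β : ℝ, 0 ≤ α ∧ 0 ≤ β ∧ α + β = 1 ∧ α*a+β*b = μ ∧ s ≤ α*a^2+β*b^2 := by
    rcases hab.eq_or_lt with h | h
    · subst h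
      have : μ = a := le_antisymm hb ha
      refine ⟨1, 0, by norm_num, by norm_num, by norm_num, by linarith, ?_⟩
      rw [this] at hup
      nlinarith
    · have h' : (0:ℝ) < b - a := by
        have : (a:ℝ) < b := by exact_mod_cast h
        linarith
      refine ⟨(b-μ)/(b-a), (μ-a)/(b-a), div_nonneg (by linarith) h'.le, div_nonneg (by linarith) h'.le, ?_, ?_, ?_⟩
      · field_simp; ring
      · field_simp; ring
      · have : (b-μ)/(b-a)*(a:ℝ)^2 + (μ-a)/(b-a)*b^2 = (a+b)*μ - a*b := by field_simp; ring
        linarith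
  obtain ⟨q, q0, qs, q1, qμ, qsq⟩ := two a b (by omega) hbr α β hα hβ hαβ hm (fun _ => ⟨le_rfl, hab⟩) (fun _ => ⟨hab, le_rfl⟩)
  have hs1 := hlow t htr
  set s1 : ℝ := (↑t + 1 - μ) * ↑t ^ 2 + (μ - ↑t) * ↑(t + 1) ^ 2 with hs1d
  have hs1' : s1 ≤ s := by rw [hs1d]; push_cast; nlinarith
  set s2 : ℝ := α * ↑a ^ 2 + β * ↑b ^ 2
  obtain ⟨l, l', hl0, hl1, hl2, hl⟩ : ∃ l l' : ℝ, 0 ≤ l ∧ 0 ≤ l' ∧ l + l' = 1 ∧ l*s1+l'*s2 = s := by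
    have : s ∈ segment ℝ s1 s2 := by rw [segment_eq_Icc (hs1'.trans hs2)]; exact ⟨hs1', hs2⟩
    obtain ⟨l, l', h1, h2, h3, h4⟩ := this
    exact ⟨l, l', h1, h2, h3, by simpa using h4⟩
  refine ⟨fun j => l * p j + l' * q j, ?_, ?_, ?_, ?_, ?_⟩
  · intro j
    exact add_nonneg (mul_nonneg hl0 (p0 j)) (mul_nonneg hl1 (q0 j))
  · intro j hj
    by_cases h : p j = 0
    · apply qs; intro h'; simp [h, h'] at hj
    · exact ps j h
  · rw [sum_add_distrib, ← mul_sum, ← mul_sum, p1, q1]; linarith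
  · simp only [add_mul, mul_assoc]
    rw [sum_add_distrib, ← mul_sum, ← mul_sum, pμ, qμ]; rw [← add_mul, hl2, one_mul]
  · simp only [add_mul, mul_assoc]
    rw [sum_add_distrib, ← mul_sum, ← mul_sum, psq, qsq]; exact hl

lemma arith (r k m u : ℕ) (hr : 3 ≤ r) (hk : 2*r+2 ≤ k) (hku : 2*m+u = k) :
    ∃ p : ℕ → ℝ, (∀ j, 0 ≤ p j) ∧ (∀ j, p j ≠ 0 → j ≤ m ∧ j ≤ r ∧ r - j ≤ u) ∧
      (∑ j ∈ range (r+1), p j * (j*(j-1))) * (k*(k-1)-2*m) = r*(r-1)*(2*m*(2*m-2)) ∧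
      (∑ j ∈ range (r+1), p j * (j*(r-j))) * (k*(k-1)-2*m) = r*(r-1)*(2*m*u) ∧
      (∑ j ∈ range (r+1), p j * ((r-j)*(r-j-1))) * (k*(k-1)-2*m) = r*(r-1)*(u*(u-1)) := by
  have hkR : (2*m+u:ℝ) = k := by exact_mod_cast hku
  have hrR : (3:ℝ) ≤ r := by exact_mod_cast hr
  have hk2 : (2*r+2:ℝ) ≤ k := by exact_mod_cast hk
  have hm0 : (0:ℝ) ≤ m := by positivity
  have hu0 : (0:ℝ) ≤ u := by positivity
  set N : ℝ := k*(k-1)-2*m with hN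
  have hN1 : (k:ℝ)*(k-2) ≤ N := by rw [hN]; nlinarith
  have hN0 : 0 < N := by nlinarith
  set μ : ℝ := r*(2*m)*(k-2)/N with hμ
  set s : ℝ := μ + r*(r-1)*(2*m)*(2*m-2)/N with hs
  have hμN : μ * N = r*(2*m)*(k-2) := by rw [hμ]; field_simp
  have hsN : s * N = r*(2*m)*(k-2) + r*(r-1)*(2*m)*(2*m-2) := by rw [hs, add_mul, hμN]; field_simp
  have hμ1 : (r:ℝ) - u ≤ μ := by
    refine le_of_mul_le_mul_right ?_ hN0
    rw [hμN]
    have h1 : 0 ≤ u * (N - r*(k-1)) := mul_nonneg hu0 (by nlinarith)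
    have : r*(2*m)*(k-2) - (r-u)*N = u * (N - r*(k-1)) := by rw [hN, ← hkR]; ring
    linarith
  have hμ0 : 0 ≤ μ := by rw [hμ]; apply div_nonneg _ hN0.le; apply mul_nonneg (by positivity); linarith
  have hμm : μ ≤ m := by
    refine le_of_mul_le_mul_right ?_ hN0
    rw [hμN]
    have h1 : 0 ≤ m * (N - 2*r*(k-2)) := mul_nonneg hm0 (by nlinarith)
    linarith
  have hμr : μ ≤ r := by
    refine le_of_mul_le_mul_right ?_ hN0
    rw [hμN]
    have : 0 ≤ r * (N - 2*m*(k-2)) := mul_nonneg (by linarith) (by rw [hN, ← hkR]; nlinarith)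
    linarith
  have hlow : ∀ t : ℕ, t + 1 ≤ r → (2*t+1)*μ - t*(t+1) ≤ s := by
    intro t ht
    have h := ineqF r k m t (by exact_mod_cast hr) (by exact_mod_cast hk) (by positivity) (by positivity) (by exact_mod_cast ht)
    have h' : (0:ℝ) ≤ t*(t+1)*(k*(k-1)-2*m) - 2*t*r*(2*m)*(k-2) + r*(r-1)*(2*m)*(2*m-2) := by exact_mod_cast h
    refine le_of_mul_le_mul_right ?_ hN0
    rw [hsN]
    have : ((2*t+1)*μ - t*(t+1)) * N = (2*t+1)*(μ*N) - t*(t+1)*N := by ring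
    rw [this, hμN, hN]
    linarith
  have main : ∃ a b : ℕ, a ≤ b ∧ b ≤ r ∧ b ≤ m ∧ r ≤ a + u ∧ (a:ℝ) ≤ μ ∧ μ ≤ b ∧ s ≤ (a+b)*μ - a*b := by
    have red : ∀ A B : ℝ, 0 ≤ (A+B)*(r*(2*m)*(k-2)) - A*B*N - (r*(2*m)*(k-2) + r*(r-1)*(2*m)*(2*m-2)) → s ≤ (A+B)*μ - A*B := by
      intro A B h
      refine le_of_mul_le_mul_right ?_ hN0
      rw [hsN]
      have : ((A+B)*μ - A*B)*N = (A+B)*(μ*N) - A*B*N := by ring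
      rw [this, hμN]
      linarith
    have hr0 : (0:ℝ) ≤ r := by linarith
    have hr1 : (0:ℝ) ≤ r - 1 := by linarith
    rcases le_or_gt r u with h1 | h1 <;> rcases le_or_gt r m with h2 | h2
    · refine ⟨0, r, by omega, by omega, h2, by omega, by simpa using hμ0, hμr, red _ _ ?_⟩
      have : (0:ℝ) ≤ r*(2*m)*(r-1)*u := by positivity
      rw [← hkR]; push_cast; linarith
    · refine ⟨0, m, by omega, by omega, le_rfl, by omega, by simpa using hμ0, hμm, red _ _ ?_⟩
      rcases Nat.eq_zero_or_pos m with h | h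
      · subst h; simp
      · have hm1 : (1:ℝ) ≤ m := by exact_mod_cast h
        have hm1' : (0:ℝ) ≤ m-1 := by linarith
        have : (0:ℝ) ≤ r*(2*m)*(m-1)*(k-2*r) := mul_nonneg (by positivity) (by linarith)
        push_cast; linarith
    · have e : ((r-u:ℕ):ℝ) = r - u := by rw [Nat.cast_sub h1.le]
      refine ⟨r-u, r, by omega, le_rfl, h2, by omega, by rw [e]; exact hμ1, hμr, red _ _ ?_⟩
      rw [e]
      rcases Nat.eq_zero_or_pos u with h | h
      · subst h
        have : (2*m:ℝ) = k := by simpa using hkR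
        apply le_of_eq
        rw [hN, ← this]; push_cast; ring
      · have hm1 : (1:ℝ) ≤ u := by exact_mod_cast h
        have hm1' : (0:ℝ) ≤ u-1 := by linarith
        have : (0:ℝ) ≤ r*u*(u-1)*(k-r) := mul_nonneg (by positivity) (by linarith)
        rw [hN, ← hkR]; rw [← hkR] at this
        linarith
    · have e : ((r-u:ℕ):ℝ) = r - u := by rw [Nat.cast_sub h1.le]
      refine ⟨r-u, m, by omega, h2.le, le_rfl, by omega, by rw [e]; exact hμ1, hμm, red _ _ ?_⟩
      rw [e]
      have h := ineqG r m u (by exact_mod_cast h2) (by exact_mod_cast h1) (by rw [← hku] at hk; exact_mod_cast hk)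
      have h' : (0:ℝ) ≤ -r*(r-1)*(u-1) + (u+r-m-1)*r*((2*m+u)-1) - (r-m)*((2*m+u)*((2*m+u)-1)-2*m) := by exact_mod_cast h
      have := mul_nonneg hu0 h'
      rw [hN, ← hkR]
      linarith
  obtain ⟨a, b, hab, hbr, hbm, hau, h1, h2, h3⟩ := main
  obtain ⟨p, p0, ps, q0, q1, q2⟩ := moment r a b (by omega) hab hbr μ s h1 h2 h3 hlow
  refine ⟨p, p0, fun j hj => ?_, ?_, ?_, ?_⟩
  · have := ps j hj
    omega
  · have : ∑ j ∈ range (r+1), p j * (j*(j-1)) = s - μ := by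
      rw [← q1, ← q2, ← sum_sub_distrib]; exact sum_congr rfl (fun _ _ => by ring)
    rw [this, sub_mul, hsN, hμN]; ring
  · have : ∑ j ∈ range (r+1), p j * ((j:ℝ)*(r-j)) = r*μ - s := by
      rw [← q1, ← q2, mul_sum, ← sum_sub_distrib]; exact sum_congr rfl (fun _ _ => by ring)
    rw [this, sub_mul, hsN, mul_assoc, hμN, ← hkR]; ring
  · have : ∑ j ∈ range (r+1), p j * (((r:ℝ)-j)*(r-j-1)) = r*(r-1)*1 - (2*r-1)*μ + s := by
      rw [← q0, ← q1, ← q2, mul_sum, mul_sum, ← sum_sub_distrib, ← sum_add_distrib]; exact sum_congr rfl (fun _ _ => by ring)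
    rw [this, add_mul, sub_mul, hsN, mul_assoc (2*(r:ℝ)-1), hμN, hN, ← hkR]; ring

lemma exists_aut {V : Type*} (σ : V → V) (hσ : ∀ v, σ (σ v) = v) (x y : V) (hxy : σ x = x ↔ σ y = y) :
    ∃ τ : Equiv.Perm V, (∀ v, τ (σ v) = σ (τ v)) ∧ τ x = y ∧
      ∀ z, z ≠ x → z ≠ y → z ≠ σ x → z ≠ σ y → τ z = z := by
  have inj : ∀ a b, σ a = σ b ↔ a = b := fun a b => ⟨fun h => by rw [← hσ a, h, hσ], fun h => by rw [h]⟩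
  have inv : ∀ a b, σ a = b ↔ a = σ b := fun a b => ⟨fun h => by rw [← h, hσ], fun h => by rw [h, hσ]⟩
  by_cases hx : σ x = x
  · have hy := hxy.1 hx
    refine ⟨Equiv.swap x y, ?_, Equiv.swap_apply_left _ _, ?_⟩
    · intro v
      simp only [Equiv.swap_apply_def]
      have e1 : σ v = x ↔ v = x := by rw [inv, hx]
      have e2 : σ v = y ↔ v = y := by rw [inv, hy]
      rw [if_congr e1 rfl (if_congr e2 rfl rfl)]
      split_ifs <;> simp [hx, hy]
    · intro z h1 h2 _ _
      exact Equiv.swap_apply_of_ne_of_ne h1 h2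
  · have hy : ¬ σ y = y := fun h => hx (hxy.2 h)
    by_cases h1 : y = x
    · subst h1
      exact ⟨1, fun _ => rfl, rfl, fun _ _ _ _ _ => rfl⟩
    by_cases h2 : y = σ x
    · subst h2
      refine ⟨Equiv.swap x (σ x), ?_, Equiv.swap_apply_left _ _, ?_⟩
      · intro v
        simp only [Equiv.swap_apply_def]
        have e1 : σ v = x ↔ v = σ x := by rw [inv]
        have e2 : σ v = σ x ↔ v = x := by rw [inj]
        rw [if_congr e1 rfl (if_congr e2 rfl rfl)]
        split_ifs with h h'
        · exfalso; subst h'; exact hx h.symm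
        · rfl
        · rw [hσ]
        · rfl
      · intro z h1 h2 _ _
        exact Equiv.swap_apply_of_ne_of_ne h1 h2
    · have h3 : σ y ≠ x := fun h => h2 ((inv _ _).1 h)
      have f : ∀ z, (Equiv.swap x y * Equiv.swap (σ x) (σ y)) z =
          if z = x then y else if z = y then x else if z = σ x then σ y else if z = σ y then σ x else z := by
        intro z
        simp only [Equiv.Perm.mul_apply, Equiv.swap_apply_def]
        grind
      refine ⟨Equiv.swap x y * Equiv.swap (σ x) (σ y), ?_, ?_, ?_⟩
      · intro v
        rw [f, f]
        grind
      · rw [f]; simp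
      · intro z a b c d
        rw [f]; simp [a, b, c, d]

lemma exists_aut2 {V : Type*} (σ : V → V) (hσ : ∀ v, σ (σ v) = v) (u v u' v' : V)
    (hu : σ u = u ↔ σ u' = u') (hv : σ v = v ↔ σ v' = v')
    (h : v ≠ u ∧ v ≠ σ u) (h' : v' ≠ u' ∧ v' ≠ σ u') :
    ∃ τ : Equiv.Perm V, (∀ v, τ (σ v) = σ (τ v)) ∧ τ u = u' ∧ τ v = v' := by
  obtain ⟨τ, h1, h2, -⟩ := exists_aut σ hσ u u' hu
  have hv2 : σ (τ v) = τ v ↔ σ v' = v' := by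
    rw [← h1, τ.injective.eq_iff, hv]
  obtain ⟨ρ, h3, h4, h5⟩ := exists_aut σ hσ (τ v) v' hv2
  refine ⟨ρ * τ, ?_, ?_, ?_⟩
  · intro w; simp [h1, h3]
  · simp only [Equiv.Perm.mul_apply]
    rw [h2]
    have g1 : τ v ≠ u' := by rw [← h2, Ne, τ.injective.eq_iff]; exact h.1
    have g2 : τ v ≠ σ u' := by rw [← h2, ← h1, Ne, τ.injective.eq_iff]; exact h.2
    apply h5
    · exact g1.symm
    · exact h'.1.symm
    · intro e; apply g2; rw [e, hσ]
    · intro e; apply h'.2; rw [e, hσ]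
  · simpa using h4

/-- the sum through an edge is constant on classes, and double counted -/
lemma double_count {V : Type*} [Fintype V] (σ : V → V) (hσ : ∀ v, σ (σ v) = v) (G : SimpleGraph V)
    (hG : ∀ u v, G.Adj u v ↔ v ≠ u ∧ v ≠ σ u) (r : ℕ) (w : Finset V → ℝ)
    (hw : ∀ τ : Equiv.Perm V, (∀ v, τ (σ v) = σ (τ v)) → ∀ s, w (s.map τ.toEmbedding) = w s)
    (P : Finset (V × V)) (u v : V) (huv : G.Adj u v)
    (hP : ∀ q : V × V, q ∈ P ↔ (G.Adj q.1 q.2 ∧ (σ q.1 = q.1 ↔ σ u = u) ∧ (σ q.2 = q.2 ↔ σ v = v))) :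
    (P.card : ℝ) * ∑ s ∈ univ.filter (fun s : Finset V => G.IsNClique r s ∧ u ∈ s ∧ v ∈ s), w s
      = ∑ s ∈ univ.filter (fun s : Finset V => G.IsNClique r s),
          w s * ((P.filter (fun q => q.1 ∈ s ∧ q.2 ∈ s)).card : ℝ) := by
  have const : ∀ q ∈ P, ∑ s ∈ univ.filter (fun s : Finset V => G.IsNClique r s ∧ q.1 ∈ s ∧ q.2 ∈ s), w s
      = ∑ s ∈ univ.filter (fun s : Finset V => G.IsNClique r s ∧ u ∈ s ∧ v ∈ s), w s := by
    intro q hq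
    obtain ⟨a1, a2, a3⟩ := (hP q).1 hq
    obtain ⟨τ, t1, t2, t3⟩ := exists_aut2 σ hσ q.1 q.2 u v a2 a3 ((hG _ _).1 a1) ((hG _ _).1 huv)
    have tadj : ∀ x y, G.Adj (τ x) (τ y) ↔ G.Adj x y := by
      intro x y
      rw [hG, hG, ← t1]; simp
    refine sum_nbij' (fun s => s.map τ.toEmbedding) (fun s => s.map τ.symm.toEmbedding) ?_ ?_ ?_ ?_ ?_
    · intro s hs
      simp only [mem_filter, mem_univ, true_and] at hs ⊢
      obtain ⟨h1, h2, h3⟩ := hs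
      refine ⟨⟨?_, by rw [card_map]; exact h1.2⟩, ?_, ?_⟩
      · intro x hx y hy hxy
        simp only [coe_map, Set.mem_image, mem_coe] at hx hy
        obtain ⟨x, hx, rfl⟩ := hx
        obtain ⟨y, hy, rfl⟩ := hy
        exact (tadj x y).2 (h1.1 hx hy (fun e => hxy (by rw [e])))
      · rw [← t2]; exact mem_map_of_mem τ.toEmbedding h2
      · rw [← t3]; exact mem_map_of_mem τ.toEmbedding h3
    · intro s hs
      simp only [mem_filter, mem_univ, true_and] at hs ⊢
      obtain ⟨h1, h2, h3⟩ := hs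
      refine ⟨⟨?_, by rw [card_map]; exact h1.2⟩, ?_, ?_⟩
      · intro x hx y hy hxy
        simp only [coe_map, Set.mem_image, mem_coe] at hx hy
        obtain ⟨x, hx, rfl⟩ := hx
        obtain ⟨y, hy, rfl⟩ := hy
        rw [← tadj]
        simpa using (h1.1 hx hy (fun e => hxy (by rw [e])))
      · rw [mem_map_equiv]; simpa [t2] using h2
      · rw [mem_map_equiv]; simpa [t3] using h3
    · intro s _; ext x; simp [mem_map_equiv]
    · intro s _; ext x; simp [mem_map_equiv]
    · intro s _; exact (hw τ t1 s).symm
  rw [← nsmul_eq_mul, ← sum_const, ← sum_congr rfl const]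
  simp_rw [sum_filter, card_filter]
  rw [sum_comm]
  refine sum_congr rfl fun s _ => ?_
  by_cases hs : G.IsNClique r s
  · simp only [hs, true_and, if_true]
    push_cast
    rw [mul_sum]
    exact sum_congr rfl fun q _ => by split_ifs <;> simp
  · simp [hs]

set_option maxHeartbeats 2000000 in
lemma core (r k : ℕ) (hr : 3 ≤ r) (hk : 2 * r + 2 ≤ k) (σ : Fin k → Fin k) (hσ : ∀ v, σ (σ v) = v)
    (G : SimpleGraph (Fin k)) (hG : ∀ u v, G.Adj u v ↔ v ≠ u ∧ v ≠ σ u) : fracCliqueDecomp G r := by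
  set T : Finset (Fin k) := univ.filter (fun v => v < σ v) with hT
  set A : Finset (Fin k) := univ.filter (fun v => σ v ≠ v) with hA
  set U : Finset (Fin k) := univ.filter (fun v => σ v = v) with hU
  have inj : Function.Injective σ := fun a b h => by rw [← hσ a, h, hσ]
  have cA : A.card = 2 * T.card := by
    have : A = T ∪ T.image σ := by
      ext v
      simp only [hA, hT, mem_union, mem_image, mem_filter, mem_univ, true_and]
      constructor
      · intro h
        rcases lt_or_gt_of_ne h with h | h
        · right; exact ⟨σ v, by rw [hσ]; exact h, hσ v⟩
        · left; exact h
      · rintro (h | ⟨x, h, rfl⟩)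
        · exact h.ne'
        · rw [hσ]; exact h.ne
    rw [this, card_union_of_disjoint, card_image_of_injective _ inj]
    · ring
    · rw [Finset.disjoint_left]
      intro v h1 h2
      simp only [hT, mem_image, mem_filter, mem_univ, true_and] at h1 h2
      obtain ⟨x, h, rfl⟩ := h2
      rw [hσ] at h1
      exact lt_asymm h h1
  have cAU : U.card + A.card = k := by
    have := card_filter_add_card_filter_not (s := (univ : Finset (Fin k))) (fun v => σ v = v)
    simpa [hU, hA] using this
  obtain ⟨p, p0, ps, pMM, pMU, pUU⟩ := arith r k T.card U.card hr hk (by omega)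
  set N : ℝ := k*(k-1)-2*(T.card:ℝ) with hN
  have hkR : (2*T.card+U.card:ℝ) = k := by
    have : 2 * T.card + U.card = k := by omega
    exact_mod_cast this
  have hrR : (3:ℝ) ≤ r := by exact_mod_cast hr
  have hk2 : (2*r+2:ℝ) ≤ k := by exact_mod_cast hk
  have hu0 : (0:ℝ) ≤ U.card := by positivity
  have hN0 : 0 < N := by rw [hN]; nlinarith
  set Q : Finset (Finset (Fin k)) := univ.filter (fun s => G.IsNClique r s) with hQ
  let J : Finset (Fin k) → ℕ := fun s => (s ∩ A).card
  let n : ℕ → ℕ := fun j => (Q.filter (fun s => J s = j)).card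
  have hn : ∀ j, p j ≠ 0 → n j ≠ 0 := by
    intro j hj
    obtain ⟨h1, h2, h3⟩ := ps j hj
    obtain ⟨X, hX, cX⟩ := exists_subset_card_eq h1
    obtain ⟨Y, hY, cY⟩ := exists_subset_card_eq h3
    have hXT : ∀ x ∈ X, x < σ x := fun x hx => by simpa [hT] using hX hx
    have hYU : ∀ x ∈ Y, σ x = x := fun x hx => by simpa [hU] using hY hx
    have hd : Disjoint X Y := by
      rw [Finset.disjoint_left]; intro x hx hy
      have a := hXT x hx
      rw [hYU x hy] at a
      exact lt_irrefl _ a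
    refine (card_pos.2 ⟨X ∪ Y, ?_⟩).ne'
    simp only [hQ, mem_filter, mem_univ, true_and]
    refine ⟨⟨?_, ?_⟩, ?_⟩
    · intro x hx y hy hxy
      rw [hG]
      refine ⟨hxy.symm, ?_⟩
      rintro rfl
      simp only [coe_union, Set.mem_union, mem_coe] at hx hy
      rcases hx with hx | hx
      · rcases hy with hy | hy
        · have a := hXT _ hx
          have b := hXT _ hy
          rw [hσ] at b
          exact lt_asymm a b
        · have := hYU _ hy
          rw [hσ] at this
          exact hxy this
      · exact hxy (hYU _ hx).symm
    · rw [card_union_of_disjoint hd, cX, cY]; omega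
    · have : (X ∪ Y) ∩ A = X := by
        ext x
        simp only [mem_inter, mem_union, hA, mem_filter, mem_univ, true_and]
        constructor
        · rintro ⟨h | h, h'⟩
          · exact h
          · exact absurd (hYU x h) h'
        · intro h; exact ⟨Or.inl h, (hXT x h).ne'⟩
      simp only [J, this, cX]
  set C : ℝ := N / (r*(r-1)) with hC
  have hC0 : 0 ≤ C := div_nonneg hN0.le (mul_nonneg (by linarith) (by linarith))
  let w : Finset (Fin k) → ℝ := fun s => C * (p (J s) / n (J s))
  have hJr : ∀ s ∈ Q, J s ≤ r := by
    intro s hs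
    simp only [hQ, mem_filter, mem_univ, true_and] at hs
    rw [← hs.2]
    exact card_le_card inter_subset_left
  have tot : ∀ g : ℕ → ℝ, ∑ s ∈ Q, w s * g (J s) = C * ∑ j ∈ range (r+1), p j * g j := by
    intro g
    rw [← sum_fiberwise_of_maps_to (s := Q) (t := range (r+1)) (g := J) (fun s hs => mem_range.2 (by have := hJr s hs; omega)), mul_sum]
    refine sum_congr rfl fun j _ => ?_
    have : ∑ s ∈ Q with J s = j, w s * g (J s) = ∑ s ∈ Q with J s = j, C * (p j / n j) * g j := by
      refine sum_congr rfl fun s hs => ?_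
      have : J s = j := (mem_filter.1 hs).2
      simp only [w, this]
    rw [this, sum_const, nsmul_eq_mul]
    change (n j : ℝ) * _ = _
    by_cases hp : p j = 0
    · simp [hp]
    · have : (n j : ℝ) ≠ 0 := by exact_mod_cast hn j hp
      field_simp
  have hw : ∀ τ : Equiv.Perm (Fin k), (∀ v, τ (σ v) = σ (τ v)) → ∀ s, w (s.map τ.toEmbedding) = w s := by
    intro τ hτ s
    have : J (s.map τ.toEmbedding) = J s := by
      have : s.map τ.toEmbedding ∩ A = (s ∩ A).map τ.toEmbedding := by
        ext x
        simp only [mem_inter, mem_map_equiv, hA, mem_filter, mem_univ, true_and]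
        refine and_congr_right fun _ => not_congr ?_
        have e := hτ (τ.symm x)
        rw [τ.apply_symm_apply] at e
        constructor
        · intro h; apply τ.injective; rw [e, τ.apply_symm_apply]; grind
        · intro h; rw [h, τ.apply_symm_apply] at e; grind
      simp only [J, this, card_map]
    simp only [w, this]
  have cJ : ∀ s ∈ Q, ((s ∩ U).card : ℝ) = r - J s := by
    intro s hs
    simp only [hQ, mem_filter, mem_univ, true_and] at hs
    have h1 : (s ∩ U).card + (s ∩ A).card = r := by
      rw [← hs.2, ← card_filter_add_card_filter_not (s := s) (fun v => σ v = v)]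
      congr 2 <;> ext x <;> simp [hU, hA]
    have h2 : ((s ∩ U).card : ℝ) + ((s ∩ A).card : ℝ) = r := by exact_mod_cast h1
    change _ = (r:ℝ) - ((s ∩ A).card : ℝ)
    linarith
  -- finishing principle
  have fin : ∀ (P : Finset (Fin k × Fin k)) (u v : Fin k), G.Adj u v →
      (∀ q : Fin k × Fin k, q ∈ P ↔ (G.Adj q.1 q.2 ∧ (σ q.1 = q.1 ↔ σ u = u) ∧ (σ q.2 = q.2 ↔ σ v = v))) →
      ∀ (g : ℕ → ℝ), (∀ s ∈ Q, ((P.filter (fun q => q.1 ∈ s ∧ q.2 ∈ s)).card : ℝ) = g (J s)) →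
      (∑ j ∈ range (r+1), p j * g j) * N = r*(r-1)*(P.card:ℝ) →
      ∑ s ∈ univ.filter (fun s : Finset (Fin k) => G.IsNClique r s ∧ u ∈ s ∧ v ∈ s), w s = 1 := by
    intro P u v huv hP g hg hsum
    have h := double_count σ hσ G hG r w hw P u v huv hP
    have h2 : ∑ s ∈ Q, w s * ((P.filter (fun q => q.1 ∈ s ∧ q.2 ∈ s)).card : ℝ) = P.card := by
      rw [sum_congr rfl (fun s hs => by rw [hg s hs]), tot, hC]
      have a : (r:ℝ) ≠ 0 := by linarith
      have b : (r:ℝ) - 1 ≠ 0 := by linarith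
      field_simp
      linarith
    have hpos : (P.card:ℝ) ≠ 0 := by
      have : 0 < P.card := card_pos.2 ⟨(u,v), (hP (u,v)).2 ⟨huv, Iff.rfl, Iff.rfl⟩⟩
      exact_mod_cast this.ne'
    have h3 := h.trans ((by convert rfl) : _ = ∑ s ∈ Q, w s * ((P.filter (fun q => q.1 ∈ s ∧ q.2 ∈ s)).card : ℝ))
    rw [h2] at h3
    have h4 := mul_left_cancel₀ hpos (h3.trans (mul_one _).symm)
    convert h4
  have clq : ∀ s ∈ Q, ∀ x ∈ s, ∀ y ∈ s, x ≠ y → y ≠ σ x := by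
    intro s hs x hx y hy hxy
    simp only [hQ, mem_filter, mem_univ, true_and] at hs
    exact ((hG x y).1 (hs.1 hx hy hxy)).2
  have cast_off : ∀ X : Finset (Fin k), (X.offDiag.card : ℝ) = X.card * (X.card - 1) := by
    intro X
    rw [offDiag_card, Nat.cast_sub (Nat.le_mul_self _)]; push_cast; ring
  have hMU : ∀ u v, G.Adj u v → σ u ≠ u → σ v = v → 
      ∑ s ∈ univ.filter (fun s : Finset (Fin k) => G.IsNClique r s ∧ u ∈ s ∧ v ∈ s), w s = 1 := by
    intro u v huv hu hv
    refine fin (A ×ˢ U) u v huv ?_ (fun j => j*(r-j)) ?_ ?_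
    · rintro ⟨x, y⟩
      simp only [mem_product, hA, hU, mem_filter, mem_univ, true_and, hG]
      grind
    · intro s hs
      have : (A ×ˢ U).filter (fun q => q.1 ∈ s ∧ q.2 ∈ s) = (s ∩ A) ×ˢ (s ∩ U) := by
        ext ⟨x, y⟩; simp only [mem_filter, mem_product, mem_inter]; tauto
      rw [this, card_product]; push_cast; rw [cJ s hs]
    · rw [pMU, card_product, cA]; push_cast; ring
  refine ⟨w, ?_, ?_⟩
  · intro s
    exact mul_nonneg hC0 (div_nonneg (p0 _) (by positivity))
  · intro u v huv
    suffices hh : ∑ s ∈ univ.filter (fun s : Finset (Fin k) => G.IsNClique r s ∧ u ∈ s ∧ v ∈ s), w s = 1 by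
      convert hh
    by_cases hu : σ u = u <;> by_cases hv : σ v = v
    · refine fin U.offDiag u v huv ?_ (fun j => (r-j)*(r-j-1)) ?_ ?_
      · rintro ⟨x, y⟩
        simp only [mem_offDiag, hU, mem_filter, mem_univ, true_and, hG]
        grind
      · intro s hs
        have : U.offDiag.filter (fun q => q.1 ∈ s ∧ q.2 ∈ s) = (s ∩ U).offDiag := by
          ext ⟨x, y⟩; simp only [mem_filter, mem_offDiag, mem_inter]; tauto
        rw [this, cast_off, cJ s hs]
      · rw [pUU, cast_off]
    · rw [← hMU v u huv.symm hv hu]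
      refine sum_congr ?_ fun _ _ => rfl
      ext s; simp only [mem_filter]; tauto
    · exact hMU u v huv hu hv
    · set D : Finset (Fin k × Fin k) := A.image (fun x => (x, σ x)) with hD
      have hDs : D ⊆ A.offDiag := by
        intro q hq
        simp only [hD, mem_image] at hq
        obtain ⟨x, hx, rfl⟩ := hq
        simp only [hA, mem_filter, mem_univ, true_and] at hx
        simp only [mem_offDiag, hA, mem_filter, mem_univ, true_and]
        exact ⟨hx, by rw [hσ]; exact hx.symm, hx.symm⟩
      have cD : D.card = A.card := card_image_of_injective _ (fun a b h => (Prod.mk.inj h).1)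
      have memD : ∀ x y, (x, y) ∈ D ↔ σ x ≠ x ∧ y = σ x := by
        intro x y
        simp only [hD, mem_image, hA, mem_filter, mem_univ, true_and, Prod.mk.injEq]
        constructor
        · rintro ⟨a, h, rfl, rfl⟩; exact ⟨h, rfl⟩
        · rintro ⟨h, rfl⟩; exact ⟨x, h, rfl, rfl⟩
      refine fin (A.offDiag \ D) u v huv ?_ (fun j => j*(j-1)) ?_ ?_
      · rintro ⟨x, y⟩
        simp only [mem_sdiff, memD, mem_offDiag, hA, mem_filter, mem_univ, true_and, hG]
        grind
      · intro s hs
        have : (A.offDiag \ D).filter (fun q => q.1 ∈ s ∧ q.2 ∈ s) = (s ∩ A).offDiag := by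
          ext ⟨x, y⟩
          simp only [mem_filter, mem_sdiff, memD, mem_offDiag, mem_inter]
          have := clq s hs x
          constructor
          · tauto
          · rintro ⟨⟨h1, h2⟩, ⟨h3, h4⟩, h5⟩
            exact ⟨⟨⟨h2, h4, h5⟩, fun h => this h1 y h3 h5 h.2⟩, h1, h3⟩
        rw [this, cast_off]
      · rw [pMM, card_sdiff_of_subset hDs, Nat.cast_sub (card_le_card hDs), cast_off, cD, cA]; push_cast; ring

theorem stmt0 (r k : ℕ) (hr : 3 ≤ r) (hk : 2 * r + 2 ≤ k)
    (M : Set (Sym2 (Fin k))) (hM : IsMatchingSet M) :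
    fracCliqueDecomp ((⊤ : SimpleGraph (Fin k)).deleteEdges M) r := by
  obtain ⟨hM1, hM2⟩ := hM
  have uniq : ∀ u v w, s(u,v) ∈ M → s(u,w) ∈ M → v = w := by
    intro u v w h1 h2
    by_contra hne
    refine hM2 _ h1 _ h2 ?_ u (by simp) (by simp)
    intro e
    exact hne (Sym2.congr_right.1 e)
  let σ : Fin k → Fin k := fun v => if h : ∃ w, s(v,w) ∈ M then h.choose else v
  have s1 : ∀ v w, s(v,w) ∈ M → σ v = w := by
    intro v w h
    have hex : ∃ w, s(v,w) ∈ M := ⟨w, h⟩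
    simp only [σ, dif_pos hex]
    exact uniq v _ _ hex.choose_spec h
  have s2 : ∀ v, σ v ≠ v → s(v, σ v) ∈ M := by
    intro v h
    by_cases hex : ∃ w, s(v,w) ∈ M
    · obtain ⟨w, hw⟩ := hex
      rw [s1 v w hw]; exact hw
    · simp [σ, dif_neg hex] at h
  refine core r k hr hk σ ?_ _ ?_
  · intro v
    by_cases h : σ v = v
    · rw [h, h]
    · apply s1; rw [Sym2.eq_swap]; exact s2 v h
  · intro u v
    rw [SimpleGraph.deleteEdges_adj, SimpleGraph.top_adj]
    constructor
    · rintro ⟨h1, h2⟩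
      refine ⟨h1.symm, ?_⟩
      rintro rfl
      exact h2 (s2 u h1.symm)
    · rintro ⟨h1, h2⟩
      exact ⟨h1.symm, fun h => h2 (s1 u v h).symm⟩
end

section
/- Let r ≥ 3, ℓ ≥ 1, and let G be a graph on at least 2^ℓ · r + 2^{ℓ+1} − 2 vertices such that the edge set of the complement of G can be partitioned into ℓ matchings. Then G has a fractional K_r-decomposition. -/
open Finset
open scoped Classical

def Cone {V : Type*} [Fintype V] (G : SimpleGraph V) (k : ℕ) (g : V → V → ℝ) : Prop :=
  ∃ w : Finset V → ℝ, (∀ s, 0 ≤ w s) ∧ (∀ s, w s ≠ 0 → G.IsNClique k s) ∧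
    ∀ u v : V, G.Adj u v → (∑ s : Finset V, if u ∈ s ∧ v ∈ s then w s else 0) = g u v

lemma cone_of_family {V : Type*} [Fintype V] (G : SimpleGraph V) (k : ℕ) (g : V → V → ℝ)
    {ι : Type*} [Fintype ι] (f : ι → Finset V) (c : ι → ℝ) (hc : ∀ i, 0 ≤ c i)
    (hf : ∀ i, c i ≠ 0 → G.IsNClique k (f i))
    (h : ∀ u v, G.Adj u v → (∑ i, if u ∈ f i ∧ v ∈ f i then c i else 0) = g u v) :
    Cone G k g := by
  refine ⟨fun s => ∑ i, if f i = s then c i else 0, ?_, ?_, ?_⟩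
  · intro s
    exact Finset.sum_nonneg fun i _ => by split_ifs <;> simp [hc]
  · intro s hs
    obtain ⟨i, _, hi⟩ := Finset.exists_ne_zero_of_sum_ne_zero hs
    split_ifs at hi with h1
    · exact h1 ▸ hf i hi
    · exact absurd rfl hi
  · intro u v huv
    rw [← h u v huv]
    have : ∀ s : Finset V, (if u ∈ s ∧ v ∈ s then ∑ i, (if f i = s then c i else 0) else 0)
        = ∑ i, if f i = s then (if u ∈ f i ∧ v ∈ f i then c i else 0) else 0 := by
      intro s
      split_ifs with h1
      · refine Finset.sum_congr rfl fun i _ => ?_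
        by_cases h2 : f i = s
        · simp [h2, h1]
        · simp [h2]
      · symm
        refine Finset.sum_eq_zero fun i _ => ?_
        by_cases h2 : f i = s
        · simp only [h2, if_true]; rw [if_neg h1]
        · simp [h2]
    rw [Finset.sum_congr rfl fun s _ => this s, Finset.sum_comm]
    simp

lemma fcd_iff {V : Type*} [Fintype V] (G : SimpleGraph V) (k : ℕ) :
    fracCliqueDecomp G k ↔ Cone G k (fun _ _ => 1) := by
  constructor
  · rintro ⟨w, h0, h⟩
    refine cone_of_family G k _ (fun s : Finset V => s)
      (fun s => if G.IsNClique k s then w s else 0) ?_ ?_ ?_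
    · intro s; split_ifs <;> simp [h0]
    · intro s hs; by_contra h1; simp [h1] at hs
    · intro u v huv
      rw [← h u v huv, Finset.sum_filter]
      refine Finset.sum_congr rfl fun s _ => ?_
      by_cases h1 : G.IsNClique k s <;> simp [h1]
  · rintro ⟨w, h0, h1, h⟩
    refine ⟨w, h0, fun u v huv => ?_⟩
    refine Eq.trans ?_ (h u v huv)
    rw [Finset.sum_filter]
    refine Finset.sum_congr rfl fun s _ => ?_
    by_cases h2 : G.IsNClique k s
    · simp [h2]
    · have : w s = 0 := by by_contra h3; exact h2 (h1 s h3)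
      simp [this]

lemma cone_add {V : Type*} [Fintype V] {G : SimpleGraph V} {k : ℕ} {g g' : V → V → ℝ}
    (h : Cone G k g) (h' : Cone G k g') : Cone G k (fun x y => g x y + g' x y) := by
  obtain ⟨w, a, b, c⟩ := h
  obtain ⟨w', a', b', c'⟩ := h'
  refine ⟨fun s => w s + w' s, fun s => add_nonneg (a s) (a' s), ?_, ?_⟩
  · intro s hs
    by_cases h1 : w s = 0
    · exact b' s (by intro h2; simp [h1, h2] at hs)
    · exact b s h1
  · intro u v huv
    beta_reduce
    rw [← c u v huv, ← c' u v huv, ← Finset.sum_add_distrib]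
    refine Finset.sum_congr rfl fun s _ => ?_
    split_ifs <;> simp

lemma cone_smul {V : Type*} [Fintype V] {G : SimpleGraph V} {k : ℕ} {g : V → V → ℝ}
    (h : Cone G k g) (a : ℝ) (ha : 0 ≤ a) : Cone G k (fun x y => a * g x y) := by
  obtain ⟨w, h0, b, c⟩ := h
  refine ⟨fun s => a * w s, fun s => mul_nonneg ha (h0 s), ?_, ?_⟩
  · intro s hs
    exact b s (right_ne_zero_of_mul hs)
  · intro u v huv
    beta_reduce
    rw [← c u v huv, Finset.mul_sum]
    refine Finset.sum_congr rfl fun s _ => ?_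
    split_ifs <;> simp

lemma cone_congr {V : Type*} [Fintype V] {G : SimpleGraph V} {k : ℕ} {g g' : V → V → ℝ}
    (h : Cone G k g) (hg : ∀ x y, G.Adj x y → g x y = g' x y) : Cone G k g' := by
  obtain ⟨w, a, b, c⟩ := h
  exact ⟨w, a, b, fun u v huv => by rw [c u v huv, hg u v huv]⟩

/- composition -/
lemma fcd_comp {V : Type*} [Fintype V] {G H : SimpleGraph V} {N r : ℕ} (hGH : G ≤ H)
    (hH : fracCliqueDecomp H N)
    (hT : ∀ T : Finset V, H.IsNClique N T →
      fracCliqueDecomp (G.induce {x | x ∈ T}) r) : fracCliqueDecomp G r := by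
  rw [fcd_iff] at hH ⊢
  obtain ⟨W, W0, W1, W2⟩ := hH
  have hT' : ∀ T : Finset V, ∃ w : Finset {x | x ∈ T} → ℝ, H.IsNClique N T →
      (∀ s, 0 ≤ w s) ∧ (∀ s, w s ≠ 0 → (G.induce {x | x ∈ T}).IsNClique r s) ∧
      ∀ u v, (G.induce {x | x ∈ T}).Adj u v →
        (∑ s, if u ∈ s ∧ v ∈ s then w s else 0) = 1 := by
    intro T
    by_cases h : H.IsNClique N T
    · obtain ⟨w, a, b, c⟩ := (fcd_iff _ _).1 (hT T h)
      exact ⟨w, fun _ => ⟨a, b, fun u v huv => by convert c u v huv⟩⟩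
    · exact ⟨fun _ => 0, fun h' => absurd h' h⟩
  choose w hw using hT'
  refine cone_of_family G r _ (ι := Σ T : Finset V, Finset {x | x ∈ T})
    (fun p => p.2.map (Function.Embedding.subtype _)) (fun p => W p.1 * w p.1 p.2) ?_ ?_ ?_
  · rintro ⟨T, s⟩
    by_cases h : W T = 0
    · simp [h]
    · exact mul_nonneg (W0 T) ((hw T (W1 T h)).1 s)
  · rintro ⟨T, s⟩ hs
    have h1 := left_ne_zero_of_mul hs
    have h2 := right_ne_zero_of_mul hs
    have h3 := (hw T (W1 T h1)).2.1 s h2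
    rw [SimpleGraph.isNClique_iff] at h3 ⊢
    refine ⟨?_, by simpa using h3.2⟩
    intro a ha b hb hab
    simp only [Finset.coe_map, Set.mem_image, Finset.mem_coe] at ha hb
    obtain ⟨a', ha', rfl⟩ := ha
    obtain ⟨b', hb', rfl⟩ := hb
    exact h3.1 ha' hb' (by rintro rfl; exact hab rfl)
  · intro u v huv
    refine Eq.trans ?_ (W2 u v (hGH huv))
    rw [Fintype.sum_sigma]
    refine Finset.sum_congr rfl fun T _ => ?_
    by_cases h : W T = 0
    · simp [h]
    by_cases h1 : u ∈ T ∧ v ∈ T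
    · rw [if_pos h1]
      have := (hw T (W1 T h)).2.2 ⟨u, h1.1⟩ ⟨v, h1.2⟩ (by simpa using huv)
      rw [← mul_one (W T), ← this, Finset.mul_sum]
      refine Finset.sum_congr rfl fun s _ => ?_
      simp [h1.1, h1.2]
    · rw [if_neg h1]
      refine Finset.sum_eq_zero fun s _ => ?_
      rw [if_neg]
      rintro ⟨ha, hb⟩
      apply h1
      simp only [Finset.mem_map] at ha hb
      obtain ⟨a, _, rfl⟩ := ha
      obtain ⟨b, _, rfl⟩ := hb
      exact ⟨a.2, b.2⟩

/- symmetrisation -/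
noncomputable def Cen {V : Type*} [Fintype V] (σ : V → V) : Finset (Equiv.Perm V) :=
  univ.filter fun π => ∀ x, π (σ x) = σ (π x)

lemma cen_move {V : Type*} [Fintype V] (σ : V → V) (hσ : ∀ x, σ (σ x) = x) (x x' : V)
    (h : σ x = x ↔ σ x' = x') :
    ∃ ρ ∈ Cen σ, ρ x = x' ∧ ∀ z, z ≠ x → z ≠ x' → z ≠ σ x → z ≠ σ x' → ρ z = z := by
  have inj : ∀ a b, σ a = σ b → a = b := fun a b e => by rw [← hσ a, e, hσ]
  by_cases hx : σ x = x
  · have hx' := h.1 hx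
    refine ⟨Equiv.swap x x', ?_, by simp, ?_⟩
    · simp only [Cen, Finset.mem_filter, Finset.mem_univ, true_and]
      intro z
      have := hσ z
      simp only [Equiv.swap_apply_def]
      grind
    · intro z h1 h2 _ _
      exact Equiv.swap_apply_of_ne_of_ne h1 h2
  · have hx' : σ x' ≠ x' := fun e => hx (h.2 e)
    by_cases hxx : x' = σ x
    · refine ⟨Equiv.swap x x', ?_, by simp, ?_⟩
      · simp only [Cen, Finset.mem_filter, Finset.mem_univ, true_and]
        intro z
        have := hσ z
        simp only [Equiv.swap_apply_def]
        grind
      · intro z h1 h2 _ _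
        exact Equiv.swap_apply_of_ne_of_ne h1 h2
    · refine ⟨Equiv.swap x x' * Equiv.swap (σ x) (σ x'), ?_, ?_, ?_⟩
      · simp only [Cen, Finset.mem_filter, Finset.mem_univ, true_and]
        intro z
        have := hσ z
        have := hσ x
        have := hσ x'
        simp only [Equiv.Perm.mul_apply, Equiv.swap_apply_def]
        grind
      · have := hσ x
        have := hσ x'
        simp only [Equiv.Perm.mul_apply, Equiv.swap_apply_def]
        grind
      · intro z h1 h2 h3 h4
        simp only [Equiv.Perm.mul_apply, Equiv.swap_apply_def]
        grind

lemma cen_mul {V : Type*} [Fintype V] {σ : V → V} {a b : Equiv.Perm V} (ha : a ∈ Cen σ)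
    (hb : b ∈ Cen σ) : a * b ∈ Cen σ := by
  simp only [Cen, Finset.mem_filter, Finset.mem_univ, true_and, Equiv.Perm.mul_apply] at *
  intro x; rw [hb, ha]

lemma cen_inv {V : Type*} [Fintype V] {σ : V → V} {a : Equiv.Perm V} (ha : a ∈ Cen σ) :
    a⁻¹ ∈ Cen σ := by
  simp only [Cen, Finset.mem_filter, Finset.mem_univ, true_and] at *
  intro x
  apply a.injective
  rw [ha]
  simp

lemma cen_fix {V : Type*} [Fintype V] {σ : V → V} {a : Equiv.Perm V} (ha : a ∈ Cen σ) (x : V) :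
    σ (a x) = a x ↔ σ x = x := by
  simp only [Cen, Finset.mem_filter, Finset.mem_univ, true_and] at ha
  rw [← ha]; simp

lemma cen_move2 {V : Type*} [Fintype V] (σ : V → V) (hσ : ∀ x, σ (σ x) = x) (x x' y y' : V)
    (h : σ x = x ↔ σ x' = x') (h' : σ y = y ↔ σ y' = y') (h1 : y ≠ x) (h2 : y ≠ σ x)
    (h1' : y' ≠ x') (h2' : y' ≠ σ x') :
    ∃ ρ ∈ Cen σ, ρ x = x' ∧ ρ y = y' := by
  obtain ⟨a, ha, hax, -⟩ := cen_move σ hσ x x' h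
  obtain ⟨b, hb, hby, hb'⟩ := cen_move σ hσ (a y) y' ((cen_fix ha y).trans h')
  refine ⟨b * a, cen_mul hb ha, ?_, by simpa using hby⟩
  rw [Equiv.Perm.mul_apply, hax]
  have hac : ∀ x, a (σ x) = σ (a x) := by simpa [Cen] using ha
  apply hb'
  · rw [← hax]; intro e; exact h1 (a.injective e.symm)
  · exact h1'.symm
  · intro e
    apply h2
    apply a.injective
    rw [hac, hax, e, hσ]
  · intro e; apply h2'; rw [e, hσ]

lemma orbit_count {V : Type*} [Fintype V] (σ : V → V) (K : Finset V) (O : Finset (V × V))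
    (ht : ∀ p ∈ O, ∀ q ∈ O, ∃ ρ ∈ Cen σ, ρ p.1 = q.1 ∧ ρ p.2 = q.2)
    (hi : ∀ π ∈ Cen σ, ∀ p ∈ O, (π p.1, π p.2) ∈ O) (p : V × V) (hp : p ∈ O) :
    O.card * ((Cen σ).filter fun π => π p.1 ∈ K ∧ π p.2 ∈ K).card
      = (Cen σ).card * (O.filter fun q => q.1 ∈ K ∧ q.2 ∈ K).card := by
  have e1 : ∀ q ∈ O, ((Cen σ).filter fun π => π q.1 ∈ K ∧ π q.2 ∈ K).card
      = ((Cen σ).filter fun π => π p.1 ∈ K ∧ π p.2 ∈ K).card := by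
    intro q hq
    obtain ⟨ρ, hρ, h1, h2⟩ := ht p hp q hq
    refine Finset.card_bij (fun π _ => π * ρ) ?_ ?_ ?_
    · intro π hπ
      simp only [Finset.mem_filter] at hπ ⊢
      exact ⟨cen_mul hπ.1 hρ, by simpa [h1, h2] using hπ.2⟩
    · intro a _ b _ hab
      exact mul_right_cancel hab
    · intro π hπ
      simp only [Finset.mem_filter] at hπ
      refine ⟨π * ρ⁻¹, ?_, by simp⟩
      simp only [Finset.mem_filter]
      refine ⟨cen_mul hπ.1 (cen_inv hρ), ?_⟩
      rw [← h1, ← h2]; simpa using hπ.2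
  have e2 : ∀ π ∈ Cen σ, (O.filter fun q => π q.1 ∈ K ∧ π q.2 ∈ K).card
      = (O.filter fun q => q.1 ∈ K ∧ q.2 ∈ K).card := by
    intro π hπ
    refine Finset.card_bij (fun q _ => (π q.1, π q.2)) ?_ ?_ ?_
    · intro q hq
      simp only [Finset.mem_filter] at hq ⊢
      exact ⟨hi π hπ q hq.1, hq.2⟩
    · rintro ⟨a, b⟩ _ ⟨a', b'⟩ _ hab
      simpa using hab
    · rintro q hq
      simp only [Finset.mem_filter] at hq
      refine ⟨(π⁻¹ q.1, π⁻¹ q.2), ?_, by simp⟩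
      simp only [Finset.mem_filter]
      exact ⟨hi _ (cen_inv hπ) q hq.1, by simpa using hq.2⟩
  have e3 := Finset.sum_card_bipartiteAbove_eq_sum_card_bipartiteBelow (s := O) (t := Cen σ)
    (fun (q : V × V) (π : Equiv.Perm V) => π q.1 ∈ K ∧ π q.2 ∈ K)
  simp only [Finset.bipartiteAbove, Finset.bipartiteBelow] at e3
  rw [Finset.sum_congr rfl e1, Finset.sum_congr rfl e2] at e3
  simpa using e3

noncomputable def Orb {V : Type*} [Fintype V] (σ : V → V) (P Q : Prop) : Finset (V × V) :=
  univ.filter fun p => p.2 ≠ p.1 ∧ p.2 ≠ σ p.1 ∧ (σ p.1 = p.1 ↔ P) ∧ (σ p.2 = p.2 ↔ Q)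

lemma orb_count {V : Type*} [Fintype V] (σ : V → V) (hσ : ∀ x, σ (σ x) = x) (K : Finset V)
    (P Q : Prop) (p : V × V) (hp : p ∈ Orb σ P Q) :
    (Orb σ P Q).card * ((Cen σ).filter fun π => π p.1 ∈ K ∧ π p.2 ∈ K).card
      = (Cen σ).card * ((Orb σ P Q).filter fun q => q.1 ∈ K ∧ q.2 ∈ K).card := by
  apply orbit_count _ _ _ _ _ _ hp
  · intro p hp q hq
    simp only [Orb, Finset.mem_filter, Finset.mem_univ, true_and] at hp hq
    exact cen_move2 σ hσ _ _ _ _ (hp.2.2.1.trans hq.2.2.1.symm) (hp.2.2.2.trans hq.2.2.2.symm)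
      hp.1 hp.2.1 hq.1 hq.2.1
  · intro π hπ p hp
    simp only [Orb, Finset.mem_filter, Finset.mem_univ, true_and] at hp ⊢
    have hc : ∀ x, π (σ x) = σ (π x) := by simpa [Cen] using hπ
    rw [cen_fix hπ, cen_fix hπ, ← hc]
    exact ⟨fun e => hp.1 (π.injective e), fun e => hp.2.1 (π.injective e), hp.2.2⟩

lemma card_offDiag_real {V : Type*} (S : Finset V) :
    (S.offDiag.card : ℝ) = S.card * (S.card - 1) := by
  rw [Finset.offDiag_card, Nat.cast_sub (Nat.le_mul_self _)]
  push_cast; ring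

lemma card_UU {V : Type*} [Fintype V] (σ : V → V) (K : Finset V) :
    (((Orb σ True True).filter fun q => q.1 ∈ K ∧ q.2 ∈ K).card : ℝ)
      = (K.filter fun x => σ x = x).card * ((K.filter fun x => σ x = x).card - 1) := by
  rw [← card_offDiag_real]
  congr 2
  ext ⟨x, y⟩
  simp only [Orb, Finset.mem_filter, Finset.mem_univ, true_and, Finset.mem_offDiag]
  grind

lemma card_UM {V : Type*} [Fintype V] (σ : V → V) (hσ : ∀ x, σ (σ x) = x) (K : Finset V) :
    (((Orb σ True False).filter fun q => q.1 ∈ K ∧ q.2 ∈ K).card : ℝ)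
      = (K.filter fun x => σ x = x).card * (K.filter fun x => σ x ≠ x).card := by
  rw [← Nat.cast_mul, ← Finset.card_product]
  congr 2
  ext ⟨x, y⟩
  simp only [Orb, Finset.mem_filter, Finset.mem_univ, true_and, Finset.mem_product]
  have := hσ x
  have := hσ y
  grind

lemma card_MU {V : Type*} [Fintype V] (σ : V → V) (hσ : ∀ x, σ (σ x) = x) (K : Finset V) :
    (((Orb σ False True).filter fun q => q.1 ∈ K ∧ q.2 ∈ K).card : ℝ)
      = (K.filter fun x => σ x = x).card * (K.filter fun x => σ x ≠ x).card := by
  rw [mul_comm, ← Nat.cast_mul, ← Finset.card_product]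
  congr 2
  ext ⟨x, y⟩
  simp only [Orb, Finset.mem_filter, Finset.mem_univ, true_and, Finset.mem_product]
  have := hσ x
  have := hσ y
  grind

lemma card_MM {V : Type*} [Fintype V] (σ : V → V) (K : Finset V)
    (hK : ∀ x ∈ K, ∀ y ∈ K, y ≠ x → y ≠ σ x) :
    (((Orb σ False False).filter fun q => q.1 ∈ K ∧ q.2 ∈ K).card : ℝ)
      = (K.filter fun x => σ x ≠ x).card * ((K.filter fun x => σ x ≠ x).card - 1) := by
  rw [← card_offDiag_real]
  congr 2
  ext ⟨x, y⟩
  simp only [Orb, Finset.mem_filter, Finset.mem_univ, true_and, Finset.mem_offDiag]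
  grind

lemma card_MM_all {V : Type*} [Fintype V] (σ : V → V) (hσ : ∀ x, σ (σ x) = x) :
    ((Orb σ False False).card : ℝ)
      = ((univ : Finset V).filter fun x => σ x ≠ x).card *
        (((univ : Finset V).filter fun x => σ x ≠ x).card - 2) := by
  set M := (univ : Finset V).filter fun x => σ x ≠ x with hM
  have e : Orb σ False False = (M ×ˢ M).filter fun q => q.2 ≠ q.1 ∧ q.2 ≠ σ q.1 := by
    ext ⟨x, y⟩
    simp only [Orb, Finset.mem_filter, Finset.mem_univ, true_and, Finset.mem_product, hM]
    grind
  rw [e, Finset.card_filter, Finset.sum_product]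
  push_cast
  rw [Finset.sum_congr rfl (g := fun _ => ((M.card : ℝ) - 2)), Finset.sum_const, nsmul_eq_mul]
  intro x hx
  have hx' : σ x ≠ x := by simpa [hM] using hx
  have h2 : M = insert x (insert (σ x) (M.filter fun y => y ≠ x ∧ y ≠ σ x)) := by
    ext y
    have := hσ x
    simp only [Finset.mem_insert, Finset.mem_filter, hM, Finset.mem_univ, true_and]
    grind
  have h3 : M.card = (M.filter fun y => y ≠ x ∧ y ≠ σ x).card + 2 := by
    conv_lhs => rw [h2]
    rw [Finset.card_insert_of_notMem, Finset.card_insert_of_notMem]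
    · simp
    · simp [hx'.symm]
  rw [h3]
  rw [Finset.card_filter]
  push_cast
  ring

lemma type_cone {V : Type*} [Fintype V] (σ : V → V) (hσ : ∀ x, σ (σ x) = x)
    (G : SimpleGraph V) (hG : ∀ x y, G.Adj x y ↔ y ≠ x ∧ y ≠ σ x) (k : ℕ) (u m : ℝ)
    (hu : (((univ : Finset V).filter fun x => σ x = x).card : ℝ) = u)
    (hm : (((univ : Finset V).filter fun x => σ x ≠ x).card : ℝ) = m)
    (K : Finset V) (hK : G.IsNClique k K) (j i : ℝ)
    (hj : ((K.filter fun x => σ x = x).card : ℝ) = j)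
    (hi : ((K.filter fun x => σ x ≠ x).card : ℝ) = i) :
    ∃ g, Cone G k g ∧ ∀ x y, G.Adj x y →
      (σ x = x → σ y = y → u * (u - 1) * g x y = j * (j - 1)) ∧
      (σ x = x → σ y ≠ y → u * m * g x y = j * i) ∧
      (σ x ≠ x → σ y = y → u * m * g x y = j * i) ∧
      (σ x ≠ x → σ y ≠ y → m * (m - 2) * g x y = i * (i - 1)) := by
  have hC : ((Cen σ).card : ℝ) ≠ 0 := by
    have : (1 : Equiv.Perm V) ∈ Cen σ := by simp [Cen]
    exact_mod_cast (Finset.card_pos.2 ⟨_, this⟩).ne'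
  have hc0 : Cone G k (fun x y => (((Cen σ).filter fun π => π x ∈ K ∧ π y ∈ K).card : ℝ)) := by
    refine cone_of_family G k _ (ι := Equiv.Perm V) (fun π => univ.filter fun x => π x ∈ K)
      (fun π => if π ∈ Cen σ then 1 else 0) ?_ ?_ ?_
    · intro π; split_ifs <;> simp
    · intro π hπ
      have hπ : π ∈ Cen σ := by by_contra h; simp [h] at hπ
      have hc : ∀ x, π (σ x) = σ (π x) := by simpa [Cen] using hπ
      rw [SimpleGraph.isNClique_iff] at hK ⊢
      constructor
      · intro x hx y hy hxy
        simp only [Finset.coe_filter, Finset.mem_univ, true_and, Set.mem_ofPred_eq] at hx hy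
        have := hK.1 hx hy (fun e => hxy (π.injective e))
        rw [hG] at this ⊢
        exact ⟨hxy.symm, fun e => this.2 (by rw [e, hc])⟩
      · rw [← hK.2]
        refine Finset.card_bij (fun x _ => π x) (by simp) (by simp) ?_
        intro b hb
        exact ⟨π⁻¹ b, by simpa using hb, by simp⟩
    · intro x y _
      have e : ∀ π : Equiv.Perm V, π ∈ Cen σ ↔ ∀ x, π (σ x) = σ (π x) := by simp [Cen]
      rw [Finset.natCast_card_filter]
      conv_rhs => rw [Cen, Finset.sum_filter]
      refine Finset.sum_congr rfl fun π _ => ?_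
      simp only [Finset.mem_filter, Finset.mem_univ, true_and, e]
      by_cases h1 : π x ∈ K ∧ π y ∈ K
      · simp [h1]
      · simp only [if_neg h1, ite_self]
  refine ⟨_, cone_smul hc0 ((Cen σ).card : ℝ)⁻¹ (by positivity), ?_⟩
  · intro x y hxy
    have hKK : ∀ x ∈ K, ∀ y ∈ K, y ≠ x → y ≠ σ x := by
      intro x hx y hy hxy
      exact ((hG x y).1 (hK.1 hx hy hxy.symm)).2
    have key : ∀ P Q : Prop, (σ x = x ↔ P) → (σ y = y ↔ Q) → ∀ a b : ℝ,
        ((Orb σ P Q).card : ℝ) = a →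
        (((Orb σ P Q).filter fun q => q.1 ∈ K ∧ q.2 ∈ K).card : ℝ) = b →
        a * (((Cen σ).card : ℝ)⁻¹ *
          ((Cen σ).filter fun π => π x ∈ K ∧ π y ∈ K).card) = b := by
      intro P Q hP hQ a b ha hb
      have h1 := orb_count σ hσ K P Q (x, y) (by
        simp only [Orb, Finset.mem_filter, Finset.mem_univ, true_and]
        exact ⟨((hG x y).1 hxy).1, ((hG x y).1 hxy).2, hP, hQ⟩)
      have h2 := congrArg (Nat.cast (R := ℝ)) h1
      push_cast at h2
      rw [ha, hb] at h2
      field_simp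
      exact h2
    have all : ∀ P Q : Prop, ((Orb σ P Q).card : ℝ) =
      ((Orb σ P Q).filter fun q => q.1 ∈ (univ : Finset V) ∧ q.2 ∈ (univ : Finset V)).card := by
      intro P Q; simp
    refine ⟨fun h1 h2 => ?_, fun h1 h2 => ?_, fun h1 h2 => ?_, fun h1 h2 => ?_⟩
    · refine key True True (by simp [h1]) (by simp [h2]) _ _ ?_ ?_
      · rw [all, card_UU, hu]
      · rw [card_UU, hj]
    · refine key True False (by simp [h1]) (by simp [h2]) _ _ ?_ ?_
      · rw [all, card_UM σ hσ, hu, hm]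
      · rw [card_UM σ hσ, hj, hi]
    · refine key False True (by simp [h1]) (by simp [h2]) _ _ ?_ ?_
      · rw [all, card_MU σ hσ, hu, hm]
      · rw [card_MU σ hσ, hj, hi]
    · refine key False False (by simp [h1]) (by simp [h2]) _ _ ?_ ?_
      · rw [card_MM_all σ hσ, hm]
      · rw [card_MM σ K hKK, hi]

lemma exists_transversal {V : Type*} [Fintype V] (σ : V → V) (hσ : ∀ x, σ (σ x) = x) :
    ∃ T : Finset V, (∀ x ∈ T, σ x ≠ x) ∧ (∀ x ∈ T, σ x ∉ T) ∧
      ((univ : Finset V).filter fun x => σ x ≠ x).card = 2 * T.card := by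
  let e := Fintype.equivFin V
  refine ⟨univ.filter fun x => e x < e (σ x), ?_, ?_, ?_⟩
  · intro x hx h
    simp [h] at hx
  · intro x hx h
    simp [hσ] at hx h
    exact absurd hx (not_lt.2 h.le)
  · have h1 : ((univ : Finset V).filter fun x => σ x ≠ x)
        = (univ.filter fun x => e x < e (σ x)) ∪ (univ.filter fun x => e (σ x) < e x) := by
      ext x
      simp only [Finset.mem_union, Finset.mem_filter, Finset.mem_univ, true_and]
      rw [lt_or_lt_iff_ne, e.injective.ne_iff, ne_comm]
    have h2 : (univ.filter fun x => e (σ x) < e x).card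
        = (univ.filter fun x => e x < e (σ x)).card := by
      refine Finset.card_bij (fun x _ => σ x) ?_ ?_ ?_
      · intro x hx; simpa [hσ] using hx
      · intro a _ b _ h; rw [← hσ a, h, hσ]
      · intro b hb; exact ⟨σ b, by simpa [hσ] using hb, hσ b⟩
    rw [h1, Finset.card_union_of_disjoint, h2]
    · ring
    · rw [Finset.disjoint_left]
      intro x hx hx'
      simp at hx hx'
      exact absurd hx (not_lt.2 hx'.le)

lemma exists_K {V : Type*} [Fintype V] (σ : V → V) (hσ : ∀ x, σ (σ x) = x)
    (G : SimpleGraph V) (hG : ∀ x y, G.Adj x y ↔ y ≠ x ∧ y ≠ σ x) (u m j i : ℕ)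
    (hu : ((univ : Finset V).filter fun x => σ x = x).card = u)
    (hm : ((univ : Finset V).filter fun x => σ x ≠ x).card = 2 * m)
    (hj : j ≤ u) (hi : i ≤ m) :
    ∃ K : Finset V, G.IsNClique (j + i) K ∧ (K.filter fun x => σ x = x).card = j ∧
      (K.filter fun x => σ x ≠ x).card = i := by
  obtain ⟨T, T1, T2, T3⟩ := exists_transversal σ hσ
  have hT : i ≤ T.card := by omega
  obtain ⟨B, hB, hBc⟩ := Finset.exists_subset_card_eq hT
  rw [← hu] at hj
  obtain ⟨A, hA, hAc⟩ := Finset.exists_subset_card_eq hj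
  have hA' : ∀ x ∈ A, σ x = x := fun x hx => by simpa using hA hx
  have e1 : ((A ∪ B).filter fun x => σ x = x) = A := by
    ext x
    have := T1 x
    have := @hB x
    have := hA' x
    simp only [Finset.mem_filter, Finset.mem_union]
    grind
  have e2 : ((A ∪ B).filter fun x => σ x ≠ x) = B := by
    ext x
    have := T1 x
    have := @hB x
    have := hA' x
    simp only [Finset.mem_filter, Finset.mem_union]
    grind
  refine ⟨A ∪ B, ?_, by rw [e1, hAc], by rw [e2, hBc]⟩
  rw [SimpleGraph.isNClique_iff]
  constructor
  · intro x hx y hy hxy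
    rw [hG]
    refine ⟨hxy.symm, ?_⟩
    rintro rfl
    simp only [Finset.coe_union, Set.mem_union, Finset.mem_coe] at hx hy
    rcases hx with hx | hx
    · exact hxy (hA' x hx).symm
    · rcases hy with hy | hy
      · have := hA' _ hy
        rw [hσ] at this
        exact hxy this
      · exact T2 x (hB hx) (hB hy)
  · rw [← Finset.card_filter_add_card_filter_not (s := A ∪ B) (fun x => σ x = x), e1, hAc]
    have := congrArg Finset.card e2
    rw [hBc] at this
    rw [← this]

lemma type_cone' {V : Type*} [Fintype V] (σ : V → V) (hσ : ∀ x, σ (σ x) = x)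
    (G : SimpleGraph V) (hG : ∀ x y, G.Adj x y ↔ y ≠ x ∧ y ≠ σ x) (k : ℕ) (u m : ℕ)
    (hu : ((univ : Finset V).filter fun x => σ x = x).card = u)
    (hm : ((univ : Finset V).filter fun x => σ x ≠ x).card = 2 * m)
    (c j i : ℝ) (hc : 0 ≤ c)
    (h : c ≠ 0 → ∃ a b : ℕ, (a : ℝ) = j ∧ (b : ℝ) = i ∧ a + b = k ∧ a ≤ u ∧ b ≤ m) :
    ∃ g, Cone G k g ∧ ∀ x y, G.Adj x y →
      (σ x = x → σ y = y → (u : ℝ) * (u - 1) * g x y = c * (j * (j - 1))) ∧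
      (σ x = x → σ y ≠ y → (u : ℝ) * (2 * m) * g x y = c * (j * i)) ∧
      (σ x ≠ x → σ y = y → (u : ℝ) * (2 * m) * g x y = c * (j * i)) ∧
      (σ x ≠ x → σ y ≠ y → ((2 * m : ℝ)) * (2 * m - 2) * g x y = c * (i * (i - 1))) := by
  by_cases h0 : c = 0
  · refine ⟨fun _ _ => 0, ⟨fun _ => 0, by simp, by simp, by simp⟩, ?_⟩
    simp [h0]
  · obtain ⟨a, b, rfl, rfl, rfl, ha, hb⟩ := h h0
    obtain ⟨K, hK, K1, K2⟩ := exists_K σ hσ G hG u m a b hu hm ha hb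
    obtain ⟨g, hg, hg'⟩ := type_cone σ hσ G hG (a + b) u (2 * m) (by rw [hu])
      (by rw [hm]; push_cast; ring) K hK a b (by rw [K1]) (by rw [K2])
    refine ⟨_, cone_smul hg c hc, ?_⟩
    intro x y hxy
    obtain ⟨h1, h2, h3, h4⟩ := hg' x y hxy
    refine ⟨fun p q => ?_, fun p q => ?_, fun p q => ?_, fun p q => ?_⟩
    · rw [← h1 p q]; ring
    · rw [← h2 p q]; ring
    · rw [← h3 p q]; ring
    · rw [← h4 p q]; ring

lemma orb_ne {V : Type*} [Fintype V] (σ : V → V) (hσ : ∀ x, σ (σ x) = x)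
    (u m : ℕ) (hu : ((univ : Finset V).filter fun x => σ x = x).card = u)
    (hm : ((univ : Finset V).filter fun x => σ x ≠ x).card = 2 * m) (x y : V)
    (h1 : y ≠ x) (h2 : y ≠ σ x) :
      (σ x = x → σ y = y → (u : ℝ) * (u - 1) ≠ 0) ∧
      (σ x = x → σ y ≠ y → (u : ℝ) * (2 * m) ≠ 0) ∧
      (σ x ≠ x → σ y = y → (u : ℝ) * (2 * m) ≠ 0) ∧
      (σ x ≠ x → σ y ≠ y → (2 * m : ℝ) * (2 * m - 2) ≠ 0) := by
  have key : ∀ P Q : Prop, (σ x = x ↔ P) → (σ y = y ↔ Q) → ((Orb σ P Q).card : ℝ) ≠ 0 := by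
    intro P Q hP hQ
    have : (x, y) ∈ Orb σ P Q := by
      simp only [Orb, Finset.mem_filter, Finset.mem_univ, true_and]
      exact ⟨h1, h2, hP, hQ⟩
    exact_mod_cast (Finset.card_pos.2 ⟨_, this⟩).ne'
  have all : ∀ P Q : Prop, ((Orb σ P Q).card : ℝ) =
    ((Orb σ P Q).filter fun q => q.1 ∈ (univ : Finset V) ∧ q.2 ∈ (univ : Finset V)).card := by
    intro P Q; simp
  refine ⟨fun p q => ?_, fun p q => ?_, fun p q => ?_, fun p q => ?_⟩
  · have := key True True (by simp [p]) (by simp [q])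
    rwa [all, card_UU, hu] at this
  · have := key True False (by simp [p]) (by simp [q])
    rw [all, card_UM σ hσ, hu, hm] at this
    exact_mod_cast this
  · have := key False True (by simp [p]) (by simp [q])
    rw [all, card_MU σ hσ, hu, hm] at this
    exact_mod_cast this
  · have := key False False (by simp [p]) (by simp [q])
    rw [card_MM_all σ hσ, hm] at this
    push_cast at this
    exact this

lemma three_types {V : Type*} [Fintype V] (σ : V → V) (hσ : ∀ x, σ (σ x) = x)
    (G : SimpleGraph V) (hG : ∀ x y, G.Adj x y ↔ y ≠ x ∧ y ≠ σ x) (k : ℕ) (u m : ℕ)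
    (hu : ((univ : Finset V).filter fun x => σ x = x).card = u)
    (hm : ((univ : Finset V).filter fun x => σ x ≠ x).card = 2 * m)
    (c j i : Fin 3 → ℝ) (hc : ∀ a, 0 ≤ c a)
    (h : ∀ n, c n ≠ 0 → ∃ a b : ℕ, (a : ℝ) = j n ∧ (b : ℝ) = i n ∧ a + b = k ∧ a ≤ u ∧ b ≤ m)
    (L : ℝ) (hL : 0 < L)
    (e1 : c 0 * (j 0 * (j 0 - 1)) + c 1 * (j 1 * (j 1 - 1)) + c 2 * (j 2 * (j 2 - 1))
      = L * ((u : ℝ) * (u - 1)))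
    (e2 : c 0 * (j 0 * i 0) + c 1 * (j 1 * i 1) + c 2 * (j 2 * i 2)
      = L * ((u : ℝ) * (2 * m)))
    (e3 : c 0 * (i 0 * (i 0 - 1)) + c 1 * (i 1 * (i 1 - 1)) + c 2 * (i 2 * (i 2 - 1))
      = L * ((2 * m : ℝ) * (2 * m - 2))) : fracCliqueDecomp G k := by
  rw [fcd_iff]
  obtain ⟨g0, G0, H0⟩ := type_cone' σ hσ G hG k u m hu hm (c 0) (j 0) (i 0) (hc 0) (h 0)
  obtain ⟨g1, G1, H1⟩ := type_cone' σ hσ G hG k u m hu hm (c 1) (j 1) (i 1) (hc 1) (h 1)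
  obtain ⟨g2, G2, H2⟩ := type_cone' σ hσ G hG k u m hu hm (c 2) (j 2) (i 2) (hc 2) (h 2)
  refine cone_congr (cone_smul (cone_add (cone_add G0 G1) G2) L⁻¹ (by positivity)) ?_
  intro x y hxy
  obtain ⟨a0, b0, c0, d0⟩ := H0 x y hxy
  obtain ⟨a1, b1, c1, d1⟩ := H1 x y hxy
  obtain ⟨a2, b2, c2, d2⟩ := H2 x y hxy
  obtain ⟨n1, n2, n3, n4⟩ := orb_ne σ hσ u m hu hm x y ((hG x y).1 hxy).1 ((hG x y).1 hxy).2
  rw [inv_mul_eq_one₀ hL.ne']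
  by_cases p : σ x = x <;> by_cases q : σ y = y
  · apply mul_left_cancel₀ (n1 p q)
    linear_combination -(e1) - a0 p q - a1 p q - a2 p q
  · apply mul_left_cancel₀ (n2 p q)
    linear_combination -(e2) - b0 p q - b1 p q - b2 p q
  · apply mul_left_cancel₀ (n3 p q)
    linear_combination -(e2) - c0 p q - c1 p q - c2 p q
  · apply mul_left_cancel₀ (n4 p q)
    linear_combination -(e3) - d0 p q - d1 p q - d2 p q

lemma fcd_top {V : Type*} [Fintype V] (k : ℕ) (hk : 2 ≤ k) (hV : k ≤ Fintype.card V) :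
    fracCliqueDecomp (⊤ : SimpleGraph V) k := by
  have hk' : (2 : ℝ) ≤ k := by exact_mod_cast hk
  have hn' : (2 : ℝ) ≤ Fintype.card V := by exact_mod_cast hk.trans hV
  refine three_types (fun x : V => x) (fun _ => rfl) ⊤ ?_ k (Fintype.card V) 0 (by simp) (by simp)
    ![1, 0, 0] ![k, 0, 0] ![0, 0, 0] ?_ ?_
    (k * (k - 1) / (Fintype.card V * (Fintype.card V - 1))) ?_ ?_ ?_ ?_
  · intro x y; simp [eq_comm]
  · intro a; fin_cases a <;> simp
  · intro a; fin_cases a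
    · intro _; exact ⟨k, 0, by simp, by simp, by simp, hV, le_refl _⟩
    · simp
    · simp
  · apply div_pos <;> apply mul_pos <;> linarith
  · have : (Fintype.card V : ℝ) - 1 ≠ 0 := by intro h; linarith
    have : (Fintype.card V : ℝ) ≠ 0 := by intro h; linarith
    simp; field_simp
  · simp
  · simp

lemma fcd_exact {V : Type*} [Fintype V] (σ : V → V) (hσ : ∀ x, σ (σ x) = x)
    (G : SimpleGraph V) (hG : ∀ x y, G.Adj x y ↔ y ≠ x ∧ y ≠ σ x) (k : ℕ) (hk : 2 ≤ k)
    (hV : Fintype.card V = 2 * k + 2) : fracCliqueDecomp G k := by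
  obtain ⟨T, -, -, hT⟩ := exists_transversal σ hσ
  have hs := Finset.card_filter_add_card_filter_not (s := (univ : Finset V)) (fun x => σ x = x)
  rw [Finset.card_univ, hV] at hs
  have hs' : ((univ : Finset V).filter fun x => σ x = x).card + 2 * T.card = 2 * k + 2 := by
    rw [← hT, ← hs]
  obtain ⟨t, ht⟩ : ∃ t, t + T.card = k + 1 := ⟨k + 1 - T.card, by omega⟩
  generalize T.card = m at hT hs' ht
  have hu : ((univ : Finset V).filter fun x => σ x = x).card = 2 * t := by omega
  have hk' : (2 : ℝ) ≤ k := by exact_mod_cast hk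
  rcases le_total (2 * t) k with h | h
  · obtain ⟨e, rfl⟩ := Nat.exists_eq_add_of_le h
    obtain rfl : m = t + e + 1 := by omega
    have hk2 : (2 : ℝ) ≤ 2 * t + e := by exact_mod_cast hk
    refine three_types σ hσ G hG _ _ _ hu hT
      ![t * ((2 * t + e) * (t + e) + 2 * t ^ 2 + 2 * (2 * t + e)),
        (t + 1) * (t + e + 1) * (4 * t + e), (t + e) * (t + e + 1)]
      ![t - 1, t, 2 * t] ![t + e + 1, t + e, e] ?_ ?_
      ((t + 1) * (2 * t + e) * (2 * t + e - 1) / 2) ?_ ?_ ?_ ?_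
    · intro a; fin_cases a <;> simp <;> positivity
    · intro a; fin_cases a
      · intro hne
        have ht0 : t ≠ 0 := by rintro rfl; simp at hne
        obtain ⟨t', rfl⟩ := Nat.exists_eq_succ_of_ne_zero ht0
        exact ⟨t', t' + 1 + e + 1, by simp, by simp, by omega, by omega, by omega⟩
      · intro _
        exact ⟨t, t + e, by simp, by simp, by omega, by omega, by omega⟩
      · intro _
        exact ⟨2 * t, e, by simp, by simp, by omega, by omega, by omega⟩
    · have : (0 : ℝ) < 2 * t + e - 1 := by linarith
      have : (0 : ℝ) < 2 * t + e := by linarith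
      positivity
    · simp; ring
    · simp; ring
    · simp; ring
  · have hkr : (k : ℝ) = t + m - 1 := by
      have : (t + m : ℝ) = k + 1 := by exact_mod_cast ht
      linarith
    refine three_types σ hσ G hG _ _ _ hu hT
      ![2 * k * t, 2 * k * m, t] ![t - 1, t, k] ![m, m - 1, 0] ?_ ?_
      (k * (k - 1) / 2) ?_ ?_ ?_ ?_
    · intro a; fin_cases a <;> simp <;> positivity
    · intro a; fin_cases a
      · intro hne
        have ht0 : t ≠ 0 := by rintro rfl; simp at hne
        obtain ⟨t', rfl⟩ := Nat.exists_eq_succ_of_ne_zero ht0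
        exact ⟨t', m, by simp, by simp, by omega, by omega, by omega⟩
      · intro hne
        have ht0 : m ≠ 0 := by rintro rfl; simp at hne
        obtain ⟨m', rfl⟩ := Nat.exists_eq_succ_of_ne_zero ht0
        exact ⟨t, m', by simp, by simp, by omega, by omega, by omega⟩
      · intro _
        exact ⟨k, 0, by simp, by simp, by omega, by omega, by omega⟩
    · have : (0 : ℝ) < k - 1 := by linarith
      positivity
    · simp; rw [hkr]; ring
    · simp; rw [hkr]; ring
    · simp; rw [hkr]; ring

lemma fcd_matching {V : Type*} [Fintype V] (G : SimpleGraph V)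
    (hG : ∀ x y z, y ≠ x → z ≠ x → ¬ G.Adj x y → ¬ G.Adj x z → y = z) (k : ℕ) (hk : 2 ≤ k)
    (hV : 2 * k + 2 ≤ Fintype.card V) : fracCliqueDecomp G k := by
  refine fcd_comp (H := ⊤) le_top (fcd_top (2 * k + 2) (by omega) hV) ?_
  intro T hT
  have hcard : Fintype.card {x | x ∈ T} = 2 * k + 2 := by
    rw [← hT.card_eq]; simp
  have hG' : ∀ x y z, y ≠ x → z ≠ x → ¬ (G.induce {x | x ∈ T}).Adj x y →
      ¬ (G.induce {x | x ∈ T}).Adj x z → y = z := by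
    intro x y z h1 h2 h3 h4
    exact Subtype.ext (hG x y z (fun e => h1 (Subtype.ext e)) (fun e => h2 (Subtype.ext e))
      (by simpa using h3) (by simpa using h4))
  generalize G.induce {x | x ∈ T} = H at hG'
  have hs : ∀ x, ∃ y, (y = x ∧ ∀ z, z ≠ x → H.Adj x z) ∨ (y ≠ x ∧ ¬ H.Adj x y) := by
    intro x
    by_cases h : ∃ z, z ≠ x ∧ ¬ H.Adj x z
    · obtain ⟨z, h1, h2⟩ := h
      exact ⟨z, Or.inr ⟨h1, h2⟩⟩
    · push Not at h
      exact ⟨x, Or.inl ⟨rfl, h⟩⟩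
  choose σ hs using hs
  refine fcd_exact σ ?_ H ?_ k hk hcard
  · intro x
    rcases hs x with ⟨h1, h2⟩ | ⟨h1, h2⟩
    · rw [h1, h1]
    · rcases hs (σ x) with ⟨h3, h4⟩ | ⟨h3, h4⟩
      · exact absurd (h4 x h1.symm).symm h2
      · exact hG' (σ x) _ _ h3 h1.symm h4 (fun e => h2 e.symm)
  · intro x y
    constructor
    · intro h
      refine ⟨h.ne', ?_⟩
      rintro rfl
      rcases hs x with ⟨h1, h2⟩ | ⟨h1, h2⟩
      · exact h.ne h1.symm
      · exact h2 h
    · rintro ⟨h1, h2⟩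
      by_contra h
      rcases hs x with ⟨h3, h4⟩ | ⟨h3, h4⟩
      · exact h (h4 y h1)
      · exact h2 (hG' x y _ h1 h3 h h4)

lemma main_aux (r : ℕ) (hr : 3 ≤ r) (ℓ : ℕ) : ∀ {V : Type*} [Fintype V] (G : SimpleGraph V)
    (c : Sym2 V → ℕ), 2 ^ ℓ * r + 2 ^ (ℓ + 1) - 2 ≤ Fintype.card V →
    (∀ x y, y ≠ x → ¬ G.Adj x y → c s(x, y) < ℓ) →
    (∀ x y z, y ≠ x → z ≠ x → ¬ G.Adj x y → ¬ G.Adj x z → c s(x, y) = c s(x, z) → y = z) →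
    fracCliqueDecomp G r := by
  induction ℓ with
  | zero =>
    intro V _ G c hV h1 _
    have : G = ⊤ := by
      ext x y
      simp only [SimpleGraph.top_adj]
      refine ⟨fun h => h.ne, fun h => ?_⟩
      by_contra h'
      exact absurd (h1 x y h.symm h') (Nat.not_lt_zero _)
    subst this
    exact fcd_top r (by omega) (by simpa using hV)
  | succ ℓ ih =>
    intro V _ G c hV h1 h2
    let H : SimpleGraph V :=
      { Adj := fun x y => x ≠ y ∧ (G.Adj x y ∨ c s(x, y) ≠ ℓ)
        symm := ⟨fun x y h => ⟨h.1.symm, by rw [G.adj_comm, Sym2.eq_swap]; exact h.2⟩⟩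
        loopless := ⟨fun x h => h.1 rfl⟩ }
    have hN : 1 ≤ 2 ^ ℓ := Nat.one_le_two_pow
    have hN2 : 1 * r ≤ 2 ^ ℓ * r := Nat.mul_le_mul_right r hN
    have hH : ∀ x y, y ≠ x → ¬ H.Adj x y → ¬ G.Adj x y ∧ c s(x, y) = ℓ := by
      intro x y h h'
      by_contra h3
      apply h'
      refine ⟨h.symm, ?_⟩
      tauto
    refine fcd_comp (H := H) (N := 2 ^ ℓ * r + 2 ^ (ℓ + 1) - 2) ?_ ?_ ?_
    · intro x y h
      exact ⟨h.ne, Or.inl h⟩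
    · apply fcd_matching
      · intro x y z hy hz hxy hxz
        have a := hH x y hy hxy
        have b := hH x z hz hxz
        exact h2 x y z hy hz a.1 b.1 (a.2.trans b.2.symm)
      · rw [pow_succ]; omega
      · refine le_trans ?_ hV
        have : 2 ^ (ℓ + 1) * r = 2 * (2 ^ ℓ * r) := by ring
        rw [this, pow_succ 2 (ℓ + 1), pow_succ 2 ℓ]
        omega
    · intro T hT
      refine ih (G.induce {x | x ∈ T}) (fun e => c (e.map Subtype.val)) ?_ ?_ ?_
      · rw [← hT.card_eq]; simp
      · intro x y hxy hadj
        have hne : (x : V) ≠ y := fun e => hxy (Subtype.ext e.symm)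
        have hadj' : ¬ G.Adj x y := by simpa using hadj
        have a := h1 x y hne.symm hadj'
        have b := hT.1 x.2 y.2 hne
        have b2 : c s((x : V), y) ≠ ℓ := b.2.resolve_left hadj'
        simp only [Sym2.map_mk]
        omega
      · intro x y z hy hz hxy hxz hc
        simp only [Sym2.map_mk] at hc
        exact Subtype.ext (h2 x y z (fun e => hy (Subtype.ext e)) (fun e => hz (Subtype.ext e))
          (by simpa using hxy) (by simpa using hxz) hc)

theorem stmt3 {V : Type*} [Fintype V] (G : SimpleGraph V) (r ℓ : ℕ)
    (hr : 3 ≤ r) (hℓ : 1 ≤ ℓ)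
    (hcard : 2 ^ ℓ * r + 2 ^ (ℓ + 1) - 2 ≤ Fintype.card V)
    (c : Sym2 V → Fin ℓ)
    (hc : ∀ e ∈ Gᶜ.edgeSet, ∀ f ∈ Gᶜ.edgeSet, c e = c f → e ≠ f → ∀ v : V, v ∈ e → v ∉ f) :
    fracCliqueDecomp G r := by
  refine main_aux r hr ℓ G (fun e => (c e : ℕ)) hcard ?_ ?_
  · intro x y _ _
    exact (c s(x, y)).2
  · intro x y z hy hz hxy hxz h
    by_contra hyz
    refine hc s(x, y) ?_ s(x, z) ?_ (Fin.ext h) ?_ x (by simp) (by simp)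
    · simp [hy.symm, hxy]
    · simp [hz.symm, hxz]
    · intro e
      rw [Sym2.congr_right] at e
      exact hyz e
end

section
/- Let r ≥ 3 and let f : E(K_{2r+2}) → [1 − 1/(2r+1), 1] be any function. Then there exist non-negative weights w_K on the copies of K_r in K_{2r+2} such that for every edge e of K_{2r+2}, the sum of w_K over copies K containing e equals f(e). -/
open Finset
open scoped Classical

section Aux

variable {V : Type*} [Fintype V] [DecidableEq V]

noncomputable def ind (r : ℕ) (s : Finset V) (u v : V) : ℝ :=
  if s.card = r ∧ u ∈ s ∧ v ∈ s then 1 else 0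

def Feas (r : ℕ) (h : V → V → ℝ) : Prop :=
  ∃ w : Finset V → ℝ, (∀ s, 0 ≤ w s) ∧ ∀ u v, u ≠ v → ∑ s, w s * ind r s u v = h u v

lemma Feas.add {r : ℕ} {h k : V → V → ℝ} (hh : Feas r h) (hk : Feas r k) :
    Feas r (fun u v => h u v + k u v) := by
  obtain ⟨w, hw, hw'⟩ := hh
  obtain ⟨x, hx, hx'⟩ := hk
  refine ⟨fun s => w s + x s, fun s => add_nonneg (hw s) (hx s), fun u v huv => ?_⟩
  simp only [add_mul, sum_add_distrib, hw' u v huv, hx' u v huv]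

lemma Feas.smul {r : ℕ} {h : V → V → ℝ} (c : ℝ) (hc : 0 ≤ c) (hh : Feas r h) :
    Feas r (fun u v => c * h u v) := by
  obtain ⟨w, hw, hw'⟩ := hh
  refine ⟨fun s => c * w s, fun s => mul_nonneg hc (hw s), fun u v huv => ?_⟩
  simp only [mul_assoc, ← mul_sum, hw' u v huv]

lemma Feas.congr {r : ℕ} {h k : V → V → ℝ} (hh : Feas r h)
    (e : ∀ u v, u ≠ v → h u v = k u v) : Feas r k := by
  obtain ⟨w, hw, hw'⟩ := hh
  exact ⟨w, hw, fun u v huv => by rw [hw' u v huv, e u v huv]⟩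

lemma Feas.sum {r : ℕ} {ι : Type*} (I : Finset ι) (h : ι → V → V → ℝ)
    (hh : ∀ i ∈ I, Feas r (h i)) : Feas r (fun u v => ∑ i ∈ I, h i u v) := by
  induction I using Finset.induction_on with
  | empty => exact ⟨fun _ => 0, fun _ => le_rfl, fun u v _ => by simp⟩
  | insert a I ha ih =>
    refine ((hh a (mem_insert_self _ _)).add
      (ih fun i hi => hh i (mem_insert_of_mem hi))).congr ?_
    intro u v _
    rw [sum_insert ha]

lemma Feas.ind {r : ℕ} (s : Finset V) : Feas r (ind r s) := by
  refine ⟨fun t => if t = s then 1 else 0, fun t => by positivity, fun u v _ => ?_⟩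
  simp

lemma Feas.map {W : Type*} [Fintype W] [DecidableEq W] {r : ℕ} {h : V → V → ℝ} (e : W ≃ V)
    (hh : Feas r h) : Feas r (fun u v : W => h (e u) (e v)) := by
  obtain ⟨w, hw, hw'⟩ := hh
  refine ⟨fun s => w (s.map e.toEmbedding), fun s => hw _, fun u v huv => ?_⟩
  show _ = h (e u) (e v)
  rw [← hw' (e u) (e v) (by simpa using huv)]
  refine Fintype.sum_equiv (Equiv.finsetCongr e) _ _ ?_
  intro s
  simp [_root_.ind]

lemma orbit_sum (G : Subgroup (Equiv.Perm V)) (C : Finset (V × V))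
    (hC : ∀ σ ∈ G, ∀ p ∈ C, (σ p.1, σ p.2) ∈ C)
    (tr : ∀ p ∈ C, ∀ q ∈ C, ∃ σ ∈ G, σ p.1 = q.1 ∧ σ p.2 = q.2)
    (h : V → V → ℝ) (c : ℝ) (hs : ∑ p ∈ C, h p.1 p.2 = C.card * c) :
    ∀ p ∈ C, ∑ σ : G, h (σ.1 p.1) (σ.1 p.2) = Fintype.card G * c := by
  intro p hp
  have h1 : ∀ q ∈ C, ∑ σ : G, h (σ.1 q.1) (σ.1 q.2) = ∑ σ : G, h (σ.1 p.1) (σ.1 p.2) := by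
    intro q hq
    obtain ⟨τ, hτ, e1, e2⟩ := tr p hp q hq
    refine Fintype.sum_equiv (Equiv.mulRight (⟨τ, hτ⟩ : G)) _ _ ?_
    intro σ
    simp [e1, e2]
  have h2 : ∀ σ : G, ∑ q ∈ C, h (σ.1 q.1) (σ.1 q.2) = C.card * c := by
    intro σ
    rw [← hs]
    refine Finset.sum_bij' (fun q _ => (σ.1 q.1, σ.1 q.2))
      (fun q _ => ((σ⁻¹ : G).1 q.1, (σ⁻¹ : G).1 q.2)) ?_ ?_ ?_ ?_ ?_
    · intro q hq; exact hC _ σ.2 q hq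
    · intro q hq; exact hC _ (σ⁻¹).2 q hq
    · intro q hq; simp
    · intro q hq; simp
    · intro q hq; simp
  have h3 : (C.card : ℝ) * ∑ σ : G, h (σ.1 p.1) (σ.1 p.2) = C.card * (Fintype.card G * c) := by
    rw [← nsmul_eq_mul, ← Finset.sum_const, ← Finset.sum_congr rfl h1, Finset.sum_comm,
      Finset.sum_congr rfl (fun σ _ => h2 σ)]
    simp
    ring
  have h4 : (C.card : ℝ) ≠ 0 := by
    have := Finset.card_pos.2 ⟨p, hp⟩
    positivity
  exact mul_left_cancel₀ h4 h3

lemma Feas.avg {r : ℕ} (G : Subgroup (Equiv.Perm V)) (h h0 : V → V → ℝ) (hh : Feas r h0)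
    (e : ∀ u v, u ≠ v → ∑ σ : G, h0 (σ.1 u) (σ.1 v) = Fintype.card G * h u v) : Feas r h := by
  refine ((Feas.sum univ (fun (σ : G) u v => h0 (σ.1 u) (σ.1 v))
    (fun σ _ => hh.map σ.1)).smul (1 / (Fintype.card G : ℝ)) (by positivity)).congr ?_
  intro u v huv
  rw [e u v huv]
  have : (Fintype.card G : ℝ) ≠ 0 := by
    have := Fintype.card_pos (α := G)
    positivity
  field_simp

/-- the weights -/
lemma weights (r s : ℕ) (hr : 3 ≤ r) (hs : s ≤ r + 1) :
    ∃ (t : Fin 3 → ℕ) (l : Fin 3 → ℝ), (∀ i, 0 ≤ l i) ∧ (∀ i, t i ≤ r ∧ t i ≤ 2 * s ∧ s ≤ t i + 1) ∧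
      ∑ i, l i * ((t i : ℝ) * (t i - 1)) = 2 * s * (2 * s - 1) ∧
      ∑ i, l i * ((t i : ℝ) * (r - t i)) = 4 * s * (r + 1 - s) ∧
      ∑ i, l i * (((r : ℝ) - t i) * (r - t i - 1)) = 4 * (r + 1 - s) * (r - s) := by
  have hr' : (3 : ℝ) ≤ r := by exact_mod_cast hr
  have hR : (0 : ℝ) < r * (r - 1) := by nlinarith
  have hr0 : (r : ℝ) ≠ 0 := by linarith
  have hr1 : (r : ℝ) - 1 ≠ 0 := by linarith
  rcases Nat.eq_zero_or_pos s with h0 | hpos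
  · subst h0
    refine ⟨fun _ => 0, ![4 * (r + 1) / (r - 1), 0, 0], ?_, ?_, ?_, ?_, ?_⟩
    · intro i
      have : 0 ≤ 4 * ((r : ℝ) + 1) / (r - 1) := div_nonneg (by linarith) (by linarith)
      fin_cases i <;> simp [this]
    · intro i; simp
    · simp
    · simp
    · simp [Fin.sum_univ_three]; field_simp
  rcases Nat.lt_or_ge r s with h1 | h1
  · obtain rfl : s = r + 1 := by omega
    refine ⟨fun _ => r, ![(4 * r + 2) * (r + 1) / (r * (r - 1)), 0, 0], ?_, ?_, ?_, ?_, ?_⟩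
    · intro i
      have : 0 ≤ (4 * (r : ℝ) + 2) * (r + 1) / (r * (r - 1)) := div_nonneg (by positivity) hR.le
      fin_cases i <;> simp [this]
    · intro i; simp; omega
    · simp [Fin.sum_univ_three]; field_simp; ring
    · simp
    · simp
  have h1' : (s : ℝ) ≤ r := by exact_mod_cast h1
  have hp' : (1 : ℝ) ≤ s := by exact_mod_cast hpos
  obtain ⟨a, rfl⟩ : ∃ a, s = a + 1 := ⟨s - 1, by omega⟩
  -- generic solution
  obtain ⟨t, ht1, ht2, ht3, L, hL, hL1, hL2⟩ : ∃ t : ℕ, t ≤ r ∧ t ≤ 2 * (a + 1) ∧ a + 1 ≤ t ∧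
      ∃ L : ℝ, 0 ≤ L ∧
        L * (((t : ℝ) - (a + 1) + 1) * (t - (a + 1))) = 2 * (a + 1) * (r - (a + 1)) * (r - (a + 1) + 1) / (r * (r - 1)) ∧
        0 ≤ (4 * r * (r + 1) + 2 * ((a : ℝ) + 1)) / (r * (r - 1)) - (a + 1) * (2 * r + 2 * (a + 1)) / (r * (r - 1))
          - (t - (a + 1) + 1) * L := by
    push_cast at h1' hp'
    rcases Nat.lt_or_ge (a + 1) r with h2 | h2
    · have h2' : (a : ℝ) + 1 < r := by exact_mod_cast h2
      rcases Nat.le_total (2 * (a + 1)) r with h3 | h3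
      · have h3' : 2 * ((a : ℝ) + 1) ≤ r := by exact_mod_cast h3
        refine ⟨2 * (a + 1), h3, le_rfl, by omega,
          2 * (r - (a + 1)) * (r - (a + 1) + 1) / (r * (r - 1)) / (a + 2), ?_, ?_, ?_⟩
        · have : 0 ≤ (r : ℝ) - (a + 1) := by linarith
          exact div_nonneg (div_nonneg (by positivity) hR.le) (by positivity)
        · push_cast
          field_simp
          ring
        · have : (4 * r * (r + 1) + 2 * ((a : ℝ) + 1)) / (r * (r - 1)) - (a + 1) * (2 * r + 2 * (a + 1)) / (r * (r - 1))
            - (((2 * (a + 1) : ℕ) : ℝ) - (a + 1) + 1) * (2 * (r - (a + 1)) * (r - (a + 1) + 1) / (r * (r - 1)) / (a + 2))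
            = (4 * r * (r + 1) + 2 * ((a : ℝ) + 1) - (a + 1) * (2 * r + 2 * (a + 1)) - 2 * (r - (a + 1)) * (r - (a + 1) + 1)) / (r * (r - 1)) := by
            push_cast
            field_simp
            ring
          rw [this]
          apply div_nonneg _ hR.le
          nlinarith
      · have h3' : (r : ℝ) ≤ 2 * ((a : ℝ) + 1) := by exact_mod_cast h3
        have hd : (r : ℝ) - (a + 1) + 1 ≠ 0 := by linarith
        refine ⟨r, le_rfl, h3, h1, 2 * (a + 1) / (r * (r - 1)), ?_, ?_, ?_⟩
        · exact div_nonneg (by positivity) hR.le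
        · field_simp
        · have : (4 * r * (r + 1) + 2 * ((a : ℝ) + 1)) / (r * (r - 1)) - (a + 1) * (2 * r + 2 * (a + 1)) / (r * (r - 1))
            - (r - (a + 1) + 1) * (2 * (a + 1) / (r * (r - 1)))
            = (4 * r * (r + 1) + 2 * ((a : ℝ) + 1) - (a + 1) * (2 * r + 2 * (a + 1)) - (r - (a + 1) + 1) * (2 * (a + 1))) / (r * (r - 1)) := by
            field_simp
          rw [this]
          apply div_nonneg _ hR.le
          nlinarith
    · obtain rfl : r = a + 1 := by omega
      refine ⟨a + 1, le_rfl, by omega, le_rfl, 0, le_rfl, ?_, ?_⟩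
      · push_cast; simp
      · rw [mul_zero, sub_zero, ← sub_div]
        apply div_nonneg _ hR.le
        push_cast
        nlinarith
  have hta : ((a : ℝ) + 1) ≤ t := by exact_mod_cast ht3
  refine ⟨![a, a + 1, t], ![(a + 1) * (2 * r + 2 * (a + 1)) / (r * (r - 1)) + (t - (a + 1)) * L,
    (4 * r * (r + 1) + 2 * ((a : ℝ) + 1)) / (r * (r - 1)) - (a + 1) * (2 * r + 2 * (a + 1)) / (r * (r - 1))
          - (t - (a + 1) + 1) * L, L], ?_, ?_, ?_, ?_, ?_⟩
  · intro i
    have : 0 ≤ (a + 1) * (2 * (r : ℝ) + 2 * (a + 1)) / (r * (r - 1)) + (t - (a + 1)) * L :=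
      add_nonneg (div_nonneg (by positivity) hR.le) (mul_nonneg (by linarith) hL)
    fin_cases i
    · exact this
    · exact hL2
    · exact hL
  · intro i
    fin_cases i
    · simp; omega
    · simp; omega
    · simp; omega
  · simp only [Fin.sum_univ_three, Matrix.cons_val]
    push_cast
    linear_combination (exp := 1) hL1 + (by field_simp; ring :
      (a + 1) * (2 * r + 2 * (a + 1)) / (r * (r - 1)) * ((a : ℝ) * (a - 1)) +
      ((4 * r * (r + 1) + 2 * ((a : ℝ) + 1)) / (r * (r - 1)) - (a + 1) * (2 * r + 2 * (a + 1)) / (r * (r - 1))) * ((a + 1) * (a + 1 - 1))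
      + 2 * (a + 1) * (r - (a + 1)) * (r - (a + 1) + 1) / (r * (r - 1)) = 2 * (a + 1) * (2 * (a + 1) - 1))
  · simp only [Fin.sum_univ_three, Matrix.cons_val]
    push_cast
    linear_combination (exp := 1) - hL1 + (by field_simp; ring :
      (a + 1) * (2 * r + 2 * (a + 1)) / (r * (r - 1)) * ((a : ℝ) * (r - a)) +
      ((4 * r * (r + 1) + 2 * ((a : ℝ) + 1)) / (r * (r - 1)) - (a + 1) * (2 * r + 2 * (a + 1)) / (r * (r - 1))) * ((a + 1) * (r - (a + 1)))
      - 2 * (a + 1) * (r - (a + 1)) * (r - (a + 1) + 1) / (r * (r - 1)) = 4 * (a + 1) * (r + 1 - (a + 1)))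
  · simp only [Fin.sum_univ_three, Matrix.cons_val]
    push_cast
    linear_combination (exp := 1) hL1 + (by field_simp; ring :
      (a + 1) * (2 * r + 2 * (a + 1)) / (r * (r - 1)) * (((r : ℝ) - a) * (r - a - 1)) +
      ((4 * r * (r + 1) + 2 * ((a : ℝ) + 1)) / (r * (r - 1)) - (a + 1) * (2 * r + 2 * (a + 1)) / (r * (r - 1))) * ((r - (a + 1)) * (r - (a + 1) - 1))
      + 2 * (a + 1) * (r - (a + 1)) * (r - (a + 1) + 1) / (r * (r - 1)) = 4 * (r + 1 - (a + 1)) * (r - (a + 1)))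

end Aux

section Main

variable {ι : Type} [Fintype ι] [DecidableEq ι]

def GT (T : Finset ι) : Subgroup (Equiv.Perm (ι × Bool)) where
  carrier := {σ | (∀ u, (σ u).1 ∈ T ↔ u.1 ∈ T) ∧
    ∀ u v, u.1 ∉ T → v.1 ∉ T → ((σ u).1 = (σ v).1 ↔ u.1 = v.1)}
  mul_mem' := by
    rintro σ τ ⟨h1, h2⟩ ⟨h3, h4⟩
    refine ⟨fun u => by simp [h1, h3], fun u v hu hv => ?_⟩
    rw [Equiv.Perm.mul_apply, Equiv.Perm.mul_apply, h2 _ _ (by rwa [h3]) (by rwa [h3]), h4 _ _ hu hv]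
  one_mem' := by simp
  inv_mem' := by
    rintro σ ⟨h1, h2⟩
    have h3 : ∀ u, (σ⁻¹ u).1 ∈ T ↔ u.1 ∈ T := fun u => by
      rw [← h1]; simp
    refine ⟨h3, fun u v hu hv => ?_⟩
    rw [← h2 _ _ (by rwa [h3]) (by rwa [h3])]; simp

lemma GT_fst {T : Finset ι} {σ : Equiv.Perm (ι × Bool)} (h : ∀ u, (σ u).1 = u.1) : σ ∈ GT T :=
  ⟨fun u => by rw [h], fun u v _ _ => by rw [h, h]⟩

lemma GT_flip {T : Finset ι} (i : ι) (a b : Bool) : Equiv.swap (i, a) (i, b) ∈ GT T := by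
  apply GT_fst
  intro u
  rw [Equiv.swap_apply_def]
  split_ifs with h1 h2 <;> simp [*]

lemma GT_swapA {T : Finset ι} {u v : ι × Bool} (hu : u.1 ∈ T) (hv : v.1 ∈ T) :
    Equiv.swap u v ∈ GT T := by
  refine ⟨fun x => ?_, fun x y hx hy => ?_⟩
  · rw [Equiv.swap_apply_def]
    split_ifs with h1 h2 <;> simp [*]
  · rw [Equiv.swap_apply_of_ne_of_ne, Equiv.swap_apply_of_ne_of_ne]
    all_goals rintro rfl; contradiction

lemma GT_swapB {T : Finset ι} {i j : ι} (hi : i ∉ T) (hj : j ∉ T) :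
    (Equiv.prodCongr (Equiv.swap i j) (Equiv.refl Bool)) ∈ GT T := by
  refine ⟨fun x => ?_, fun x y hx hy => ?_⟩
  · simp only [Equiv.prodCongr_apply, Prod.map_fst]
    rw [Equiv.swap_apply_def]
    split_ifs with h1 h2 <;> simp [*]
  · simp

lemma exB {T : Finset ι} {u v : ι × Bool} (hu : u.1 ∉ T) (hv : v.1 ∉ T) :
    ∃ σ ∈ GT T, σ u = v ∧ ∀ w : ι × Bool, w.1 ≠ u.1 → w.1 ≠ v.1 → σ w = w := by
  obtain ⟨i, a⟩ := u
  obtain ⟨j, b⟩ := v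
  refine ⟨Equiv.swap (j, a) (j, b) * Equiv.prodCongr (Equiv.swap i j) (Equiv.refl Bool),
    mul_mem (GT_flip _ _ _) (GT_swapB hu hv), by simp, ?_⟩
  rintro ⟨k, c⟩ h1 h2
  simp only [ne_eq] at h1 h2
  simp only [Equiv.Perm.mul_apply, Equiv.prodCongr_apply, Prod.map_apply,
    Equiv.swap_apply_of_ne_of_ne h1 h2, Equiv.refl_apply]
  rw [Equiv.swap_apply_of_ne_of_ne] <;> simp [h2]

lemma trAA {T : Finset ι} {u v u' v' : ι × Bool} (hu : u.1 ∈ T) (hv : v.1 ∈ T) (hu' : u'.1 ∈ T)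
    (hv' : v'.1 ∈ T) (h : u ≠ v) (h' : u' ≠ v') : ∃ σ ∈ GT T, σ u = u' ∧ σ v = v' := by
  have h1 := GT_swapA hu hu'
  refine ⟨Equiv.swap (Equiv.swap u u' v) v' * Equiv.swap u u',
    mul_mem (GT_swapA ((h1.1 v).2 hv) hv') h1, ?_, by simp⟩
  simp only [Equiv.Perm.mul_apply, Equiv.swap_apply_left]
  rw [Equiv.swap_apply_of_ne_of_ne _ h']
  intro h2
  apply h
  apply (Equiv.swap u u').injective
  rw [← h2]; simp

lemma trAB {T : Finset ι} {u v u' v' : ι × Bool} (hu : u.1 ∈ T) (hv : v.1 ∉ T) (hu' : u'.1 ∈ T)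
    (hv' : v'.1 ∉ T) : ∃ σ ∈ GT T, σ u = u' ∧ σ v = v' := by
  obtain ⟨σ, hσ, h1, h2⟩ := exB hv hv'
  refine ⟨σ * Equiv.swap u u', mul_mem hσ (GT_swapA hu hu'), ?_, ?_⟩
  · simp only [Equiv.Perm.mul_apply, Equiv.swap_apply_left]
    apply h2
    · intro h; rw [h] at hu'; contradiction
    · intro h; rw [h] at hu'; contradiction
  · rw [Equiv.Perm.mul_apply, Equiv.swap_apply_of_ne_of_ne, h1]
    all_goals rintro rfl; contradiction

lemma trBB {T : Finset ι} {u v u' v' : ι × Bool} (hu : u.1 ∉ T) (hv : v.1 ∉ T) (hu' : u'.1 ∉ T)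
    (hv' : v'.1 ∉ T) (h : u.1 ≠ v.1) (h' : u'.1 ≠ v'.1) : ∃ σ ∈ GT T, σ u = u' ∧ σ v = v' := by
  obtain ⟨σ, hσ, h1, h2⟩ := exB hu hu'
  have h3 : (σ v).1 ∉ T := by rwa [hσ.1]
  obtain ⟨τ, hτ, h4, h5⟩ := exB h3 hv'
  refine ⟨τ * σ, mul_mem hτ hσ, ?_, by simp [h4]⟩
  rw [Equiv.Perm.mul_apply, h1]
  apply h5 _ _ h'
  rw [← h1, Ne, hσ.2 _ _ hu hv]
  exact h

lemma exS (r t : ℕ) (T : Finset ι) (hT : Fintype.card ι = r + 1) (h1 : t ≤ r) (h2 : t ≤ 2 * T.card)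
    (h3 : T.card ≤ t + 1) : ∃ S : Finset (ι × Bool), S.card = r ∧
      (S.filter (fun u => u.1 ∈ T)).card = t ∧ (S.filter (fun u => u.1 ∉ T)).card = r - t ∧
      ∀ u ∈ S, ∀ v ∈ S, u.1 ∉ T → u.1 = v.1 → u = v := by
  obtain ⟨P, hP, hPc⟩ := Finset.exists_subset_card_eq (s := T ×ˢ (univ : Finset Bool)) (n := t)
    (by simp; omega)
  obtain ⟨Q, hQ, hQc⟩ := Finset.exists_subset_card_eq (s := Tᶜ) (n := r - t)
    (by rw [card_compl]; omega)
  have hP' : ∀ u ∈ P, u.1 ∈ T := fun u hu => by simpa using hP hu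
  have hQ' : ∀ u ∈ Q, u ∉ T := fun u hu => by simpa using hQ hu
  have e1 : (P ∪ Q ×ˢ {false}).filter (fun u => u.1 ∈ T) = P := by
    ext ⟨i, a⟩
    simp only [mem_filter, mem_union, mem_product, mem_singleton]
    constructor
    · rintro ⟨h | h, h'⟩
      · exact h
      · exact absurd h' (hQ' _ h.1)
    · intro h; exact ⟨Or.inl h, hP' _ h⟩
  have e2 : (P ∪ Q ×ˢ {false}).filter (fun u => u.1 ∉ T) = Q ×ˢ {false} := by
    ext ⟨i, a⟩
    simp only [mem_filter, mem_union, mem_product, mem_singleton]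
    constructor
    · rintro ⟨h | h, h'⟩
      · exact absurd (hP' _ h) h'
      · exact h
    · intro h; exact ⟨Or.inr h, hQ' _ h.1⟩
  have e3 := Finset.card_filter_add_card_filter_not (s := P ∪ Q ×ˢ {false}) (fun u => u.1 ∈ T)
  refine ⟨P ∪ Q ×ˢ {false}, ?_, ?_, ?_, ?_⟩
  · rw [← e3, e1, e2]; simp; omega
  · rw [e1, hPc]
  · rw [e2]; simp [hQc]
  · rintro ⟨i, a⟩ hu ⟨j, b⟩ hv hi hij
    simp only [mem_union, mem_product, mem_singleton] at hu hv hi hij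
    subst hij
    have k1 : (i, a) ∉ P := fun h => hi (hP' _ h)
    have k2 : (i, b) ∉ P := fun h => hi (hP' _ h)
    simp [k1, k2] at hu hv
    rw [hu.2, hv.2]

lemma vertex_feas (r : ℕ) (hr : 3 ≤ r) (T : Finset ι) (hT : Fintype.card ι = r + 1) :
    Feas r (fun u v : ι × Bool => if u.1 = v.1 then (if u.1 ∈ T then (1 : ℝ) else 0) else 1) := by
  have hTc : T.card ≤ r + 1 := hT ▸ T.card_le_univ
  obtain ⟨t, l, hl, ht, w1, w2, w3⟩ := weights r T.card hr hTc
  choose S hS hSA hSB hSt using fun i => exS r (t i) T hT (ht i).1 (ht i).2.1 (ht i).2.2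
  set h0 : ι × Bool → ι × Bool → ℝ := fun u v => ∑ i, l i * ind r (S i) u v with hh0
  have F0 : Feas r h0 := Feas.sum univ _ fun i _ => (Feas.ind (S i)).smul (l i) (hl i)
  have sw : ∀ u v, h0 u v = h0 v u := by
    intro u v
    simp only [hh0, ind, and_comm (a := u ∈ _)]
  have cnt : ∀ (C : Finset ((ι × Bool) × (ι × Bool))), ∑ p ∈ C, h0 p.1 p.2 =
      ∑ i, l i * ((C.filter (fun p => p.1 ∈ S i ∧ p.2 ∈ S i)).card : ℝ) := by
    intro C
    simp only [hh0]
    rw [Finset.sum_comm]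
    refine Finset.sum_congr rfl fun i _ => ?_
    rw [← mul_sum, Finset.card_filter]
    simp [ind, hS]
  have cc : ((Tᶜ.card : ℕ) : ℝ) = r + 1 - T.card := by
    rw [card_compl, hT, Nat.cast_sub hTc]; push_cast; ring
  have od : ∀ X : Finset (ι × Bool), ((X.offDiag.card : ℕ) : ℝ) = X.card * (X.card - 1) := by
    intro X
    rw [offDiag_card, Nat.cast_sub (Nat.le_mul_self _)]; push_cast; ring
  have rt : ∀ i, ((r - t i : ℕ) : ℝ) = r - t i := fun i => by rw [Nat.cast_sub (ht i).1]
  have AA := orbit_sum (GT T) (T ×ˢ (univ : Finset Bool)).offDiag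
    (by
      intro σ hσ p hp
      simp only [mem_offDiag, mem_product, mem_univ, and_true] at hp ⊢
      exact ⟨(hσ.1 _).2 hp.1, (hσ.1 _).2 hp.2.1, fun h => hp.2.2 (σ.injective h)⟩)
    (by
      intro p hp q hq
      simp only [mem_offDiag, mem_product, mem_univ, and_true] at hp hq
      exact trAA hp.1 hp.2.1 hq.1 hq.2.1 hp.2.2 hq.2.2)
    h0 1 (by
      rw [cnt, od, mul_one]
      have : ∀ i, (((T ×ˢ (univ : Finset Bool)).offDiag.filter
          (fun p => p.1 ∈ S i ∧ p.2 ∈ S i)).card : ℝ) = (t i : ℝ) * (t i - 1) := by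
        intro i
        rw [← hSA i, ← od]
        congr 2
        ext p
        simp only [mem_filter, mem_offDiag, mem_product, mem_univ, and_true]
        tauto
      simp only [this]
      rw [w1]
      simp
      ring)
  have AB := orbit_sum (GT T) ((T ×ˢ (univ : Finset Bool)) ×ˢ (Tᶜ ×ˢ (univ : Finset Bool)))
    (by
      intro σ hσ p hp
      simp only [mem_compl, mem_product, mem_univ, and_true] at hp ⊢
      exact ⟨(hσ.1 _).2 hp.1, fun h => hp.2 ((hσ.1 _).1 h)⟩)
    (by
      intro p hp q hq
      simp only [mem_compl, mem_product, mem_univ, and_true] at hp hq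
      exact trAB hp.1 hp.2 hq.1 hq.2)
    h0 1 (by
      rw [cnt, mul_one]
      have : ∀ i, ((((T ×ˢ (univ : Finset Bool)) ×ˢ (Tᶜ ×ˢ (univ : Finset Bool))).filter
          (fun p => p.1 ∈ S i ∧ p.2 ∈ S i)).card : ℝ) = (t i : ℝ) * (r - t i) := by
        intro i
        rw [← rt, ← hSB i]
        nth_rewrite 1 [← hSA i]
        rw [← Nat.cast_mul, ← card_product]
        congr 2
        ext p
        simp only [mem_filter, mem_compl, mem_product, mem_univ, and_true]
        tauto
      simp only [this]
      rw [w2]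
      rw [card_product, card_product, card_product]
      push_cast
      rw [cc]
      simp
      ring)
  have BB := orbit_sum (GT T) (((Tᶜ ×ˢ (univ : Finset Bool)) ×ˢ (Tᶜ ×ˢ (univ : Finset Bool))).filter
      (fun p => p.1.1 ≠ p.2.1))
    (by
      intro σ hσ p hp
      simp only [mem_filter, mem_compl, mem_product, mem_univ, and_true] at hp ⊢
      exact ⟨⟨fun h => hp.1.1 ((hσ.1 _).1 h), fun h => hp.1.2 ((hσ.1 _).1 h)⟩,
        fun h => hp.2 ((hσ.2 _ _ hp.1.1 hp.1.2).1 h)⟩)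
    (by
      intro p hp q hq
      simp only [mem_filter, mem_compl, mem_product, mem_univ, and_true] at hp hq
      exact trBB hp.1.1 hp.1.2 hq.1.1 hq.1.2 hp.2 hq.2)
    h0 1 (by
      rw [cnt, mul_one]
      have : ∀ i, (((((Tᶜ ×ˢ (univ : Finset Bool)) ×ˢ (Tᶜ ×ˢ (univ : Finset Bool))).filter
          (fun p => p.1.1 ≠ p.2.1)).filter
          (fun p => p.1 ∈ S i ∧ p.2 ∈ S i)).card : ℝ) = ((r : ℝ) - t i) * (r - t i - 1) := by
        intro i
        rw [← rt, ← hSB i, ← od]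
        congr 2
        ext p
        simp only [mem_filter, mem_offDiag, mem_compl, mem_product, mem_univ, and_true]
        constructor
        · rintro ⟨⟨⟨h1, h2⟩, h3⟩, h4, h5⟩
          exact ⟨⟨h4, h1⟩, ⟨h5, h2⟩, fun h => h3 (by rw [h])⟩
        · rintro ⟨⟨h4, h1⟩, ⟨h5, h2⟩, h3⟩
          exact ⟨⟨⟨h1, h2⟩, fun h => h3 (hSt i _ h4 _ h5 h1 h)⟩, h4, h5⟩
      simp only [this]
      rw [w3]
      have e : (((Tᶜ ×ˢ (univ : Finset Bool)) ×ˢ (Tᶜ ×ˢ (univ : Finset Bool))).filter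
          (fun p => p.1.1 ≠ p.2.1)).card = (Tᶜ.offDiag ×ˢ (univ : Finset (Bool × Bool))).card := by
        refine Finset.card_nbij' (fun p => ((p.1.1, p.2.1), (p.1.2, p.2.2)))
          (fun p => ((p.1.1, p.2.1), (p.1.2, p.2.2))) ?_ ?_ ?_ ?_
        · intro p hp
          simp at hp ⊢; tauto
        · intro p hp
          simp at hp ⊢; tauto
        · intro p hp; rfl
        · intro p hp; rfl
      rw [e, card_product, offDiag_card, Nat.cast_mul, Nat.cast_sub (Nat.le_mul_self _)]
      push_cast
      rw [cc]
      simp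
      ring)
  refine Feas.avg (GT T) _ h0 F0 ?_
  intro u v huv
  by_cases hu : u.1 ∈ T <;> by_cases hv : v.1 ∈ T
  · have := AA (u, v) (by simp [hu, hv, huv])
    simpa [hu] using this
  · have := AB (u, v) (by simp [hu, hv])
    have ne : u.1 ≠ v.1 := fun h => hv (h ▸ hu)
    simpa [ne] using this
  · have := AB (v, u) (by simp [hu, hv])
    have ne : u.1 ≠ v.1 := fun h => hu (h ▸ hv)
    simp only [sw (_ : ι × Bool)] at this ⊢
    simp only [ne, if_false]
    rw [← this]
  · by_cases e : u.1 = v.1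
    · simp only [e, hv, if_true, if_false, mul_zero]
      apply Finset.sum_eq_zero
      intro σ _
      apply Finset.sum_eq_zero
      intro i _
      rw [ind, if_neg, mul_zero]
      rintro ⟨_, h1, h2⟩
      apply huv
      apply σ.1.injective
      exact hSt i _ h1 _ h2 (fun h => hu ((σ.2.1 _).1 h)) ((σ.2.2 _ _ hu hv).2 e)
    · have := BB (u, v) (by simp [hu, hv, e])
      simpa [e] using this

lemma cube_feas (r : ℕ) (hr : 3 ≤ r) (hT : Fintype.card ι = r + 1) (x : ι → ℝ)
    (hx : ∀ i, 0 ≤ x i ∧ x i ≤ 1) :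
    Feas r (fun u v : ι × Bool => if u.1 = v.1 then x u.1 else 1) := by
  have hc : Convex ℝ {x : ι → ℝ | Feas r (fun u v : ι × Bool => if u.1 = v.1 then x u.1 else 1)} := by
    intro x hx y hy a b ha hb hab
    refine ((Feas.smul a ha hx).add (Feas.smul b hb hy)).congr ?_
    intro u v _
    by_cases h : u.1 = v.1
    · simp [h]
    · simp [h, hab]
  have hsub : Set.pi Set.univ (fun _ : ι => ({0, 1} : Set ℝ)) ⊆
      {x : ι → ℝ | Feas r (fun u v : ι × Bool => if u.1 = v.1 then x u.1 else 1)} := by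
    intro y hy
    refine (vertex_feas r hr (univ.filter (fun i => y i = 1)) hT).congr ?_
    intro u v _
    have := hy u.1 (Set.mem_univ _)
    rcases this with h | h
    · simp [h]
    · rw [Set.mem_singleton_iff] at h
      simp [h]
  have hm := convexHull_min hsub hc
  rw [convexHull_pi] at hm
  apply hm
  intro i _
  rw [convexHull_pair, segment_eq_Icc zero_le_one]
  exact hx i

lemma match_sum (r : ℕ) (hT : Fintype.card ι = r + 1) (u v : ι × Bool) (huv : u ≠ v) :
    ∑ σ : (⊤ : Subgroup (Equiv.Perm (ι × Bool))), (if (σ.1 u).1 = (σ.1 v).1 then (1 : ℝ) else 0) =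
      Fintype.card (⊤ : Subgroup (Equiv.Perm (ι × Bool))) * (1 / (2 * (r : ℝ) + 1)) := by
  have := orbit_sum (⊤ : Subgroup (Equiv.Perm (ι × Bool))) (univ : Finset (ι × Bool)).offDiag
    (by
      intro σ _ p hp
      simpa using hp)
    (by
      intro p hp q hq
      simp only [mem_offDiag, mem_univ, true_and] at hp hq
      obtain ⟨σ, _, h⟩ := trAA (T := (univ : Finset ι)) (mem_univ _) (mem_univ _) (mem_univ _)
        (mem_univ _) hp hq
      exact ⟨σ, trivial, h⟩)
    (fun u v => if u.1 = v.1 then (1 : ℝ) else 0) (1 / (2 * (r : ℝ) + 1))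
    (by
      rw [← Finset.sum_filter (s := (univ : Finset (ι × Bool)).offDiag) (fun p => p.1.1 = p.2.1)
        (fun _ => (1 : ℝ))]
      rw [Finset.sum_const, offDiag_card, nsmul_eq_mul, mul_one, Nat.cast_sub (Nat.le_mul_self _)]
      have e : ((univ : Finset (ι × Bool)).offDiag.filter (fun p => p.1.1 = p.2.1)).card
          = (univ : Finset (ι × Bool)).card := by
        refine Finset.card_nbij' (fun p => p.1) (fun p => (p, (p.1, !p.2))) ?_ ?_ ?_ ?_
        · intro p hp; simp
        · intro p hp; simp [Prod.ext_iff]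
        · rintro ⟨⟨i, a⟩, ⟨j, b⟩⟩ hp
          simp at hp
          obtain ⟨h1, rfl⟩ := hp
          cases a <;> cases b <;> simp at h1 ⊢
        · intro p hp; rfl
      rw [e]
      simp [hT]
      field_simp
      ring)
  exact this (u, v) (by simpa using huv)

end Main

theorem stmt4 (r : ℕ) (hr : 3 ≤ r) (f : Sym2 (Fin (2 * r + 2)) → ℝ)
    (hf : ∀ u v : Fin (2 * r + 2), u ≠ v →
      1 - 1 / (2 * (r : ℝ) + 1) ≤ f s(u, v) ∧ f s(u, v) ≤ 1) :
    ∃ w : Finset (Fin (2 * r + 2)) → ℝ, (∀ s, 0 ≤ w s) ∧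
      ∀ u v : Fin (2 * r + 2), u ≠ v →
        ∑ s ∈ univ.filter (fun s : Finset (Fin (2 * r + 2)) =>
            (⊤ : SimpleGraph (Fin (2 * r + 2))).IsNClique r s ∧ u ∈ s ∧ v ∈ s),
          w s = f s(u, v) := by
  have key : Feas r (fun u v : Fin (2 * r + 2) => f s(u, v)) := by
    have e : Fin (2 * r + 2) ≃ Fin (r + 1) × Bool :=
      Fintype.equivOfCardEq (by simp; ring)
    have hc : Fintype.card (Fin (r + 1)) = r + 1 := by simp
    have hp : (0 : ℝ) < 2 * (r : ℝ) + 1 := by positivity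
    set F : Fin (r + 1) × Bool → Fin (r + 1) × Bool → ℝ := fun u v => f s(e.symm u, e.symm v) with hF
    have Fs : ∀ u v, F u v = F v u := fun u v => by simp only [hF]; rw [Sym2.eq_swap]
    have Fb : ∀ u v, u ≠ v → 1 - 1 / (2 * (r : ℝ) + 1) ≤ F u v ∧ F u v ≤ 1 := fun u v h =>
      hf _ _ (by simpa using h)
    have FF : Feas r F := by
      have h1 : ∀ σ : (⊤ : Subgroup (Equiv.Perm (Fin (r + 1) × Bool))),
          Feas r (fun u v => 1 - (if (σ.1 u).1 = (σ.1 v).1 then (1 : ℝ) else 0) *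
            ((2 * (r : ℝ) + 1) * (1 - F u v))) := by
        intro σ
        refine ((cube_feas r hr hc (fun i => 1 - (2 * (r : ℝ) + 1) *
          (1 - F (σ.1.symm (i, false)) (σ.1.symm (i, true)))) ?_).map σ.1).congr ?_
        · intro i
          have := Fb (σ.1.symm (i, false)) (σ.1.symm (i, true)) (by simp)
          have h2 : (2 * (r : ℝ) + 1) * (1 - F (σ.1.symm (i, false)) (σ.1.symm (i, true)))
              ≤ (2 * (r : ℝ) + 1) * (1 / (2 * (r : ℝ) + 1)) :=
            mul_le_mul_of_nonneg_left (by linarith) hp.le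
          rw [mul_one_div_cancel hp.ne'] at h2
          have h3 : 0 ≤ (2 * (r : ℝ) + 1) * (1 - F (σ.1.symm (i, false)) (σ.1.symm (i, true))) :=
            mul_nonneg hp.le (by linarith)
          constructor <;> linarith
        · intro u v huv
          obtain ⟨⟨i, a⟩, rfl⟩ := σ.1.symm.surjective u
          obtain ⟨⟨j, b⟩, rfl⟩ := σ.1.symm.surjective v
          simp only [Equiv.apply_symm_apply]
          by_cases hij : i = j
          · subst hij
            have hab : a ≠ b := by rintro rfl; exact huv rfl
            simp only [if_true, one_mul]
            cases a <;> cases b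
            · exact absurd rfl hab
            · rfl
            · rw [Fs]
            · exact absurd rfl hab
          · simp [hij]
      have hN : (0 : ℝ) < Fintype.card (⊤ : Subgroup (Equiv.Perm (Fin (r + 1) × Bool))) := by
        exact_mod_cast Fintype.card_pos
      refine ((Feas.sum univ _ (fun σ _ => h1 σ)).smul
        (1 / (Fintype.card (⊤ : Subgroup (Equiv.Perm (Fin (r + 1) × Bool))) : ℝ))
        (by positivity)).congr ?_
      intro u v huv
      rw [Finset.sum_sub_distrib, ← Finset.sum_mul, match_sum r hc u v huv, Finset.sum_const,
        Finset.card_univ, nsmul_eq_mul]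
      field_simp
      ring
    refine (FF.map e).congr ?_
    intro u v _
    simp [hF]
  obtain ⟨w, hw, hw'⟩ := key
  refine ⟨w, hw, fun u v huv => ?_⟩
  refine Eq.trans ?_ (hw' u v huv)
  rw [Finset.sum_filter]
  refine Finset.sum_congr rfl fun s _ => ?_
  have : (⊤ : SimpleGraph (Fin (2 * r + 2))).IsNClique r s ↔ s.card = r := by
    rw [SimpleGraph.isNClique_iff]
    refine ⟨fun h => h.2, fun h => ⟨?_, h⟩⟩
    intro a _ b _ hab
    simpa using hab
  simp [ind, this]
end
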